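/- arXiv:math/0010070 — 4 statements merged into one kernel-verified Lean document; each statement's English description precedes it below -/
import Mathlib

section
/- There exist a set Y ⊆ ℝ of positive outer Lebesgue measure and a function f : Y → ℝ such that for every X ⊆ Y of positive outer Lebesgue measure, the restriction f↾X (with X carrying the subspace topology of ℝ) is not continuous. -/
open MeasureTheory

/-- A non-null set of reals with a well order all of whose initial segments are null. -/
lemma exists_nonnull_wellOrder : ∃ (Y : Set ℝ) (r : ℝ → ℝ → Prop), IsWellOrder ℝ r ∧
    0 < volume Y ∧ ∀ y ∈ Y, volume {x | x ∈ Y ∧ r x y} = 0 := by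
  let r : ℝ → ℝ → Prop := WellOrderingRel
  have hr : IsWellOrder ℝ r := WellOrderingRel.isWellOrder
  by_cases h : ∃ a, volume {x | r x a} ≠ 0
  · have hwf : WellFounded r := hr.wf
    refine ⟨{x | r x (hwf.min {a | volume {x | r x a} ≠ 0} h)}, r, hr, ?_, ?_⟩
    · exact pos_iff_ne_zero.2 (hwf.min_mem {a | volume {x | r x a} ≠ 0} h)
    · intro y hy
      have h1 : volume {x | r x y} = 0 := by
        by_contra hne
        exact hwf.not_lt_min {a | volume {x | r x a} ≠ 0} hne hy
      exact measure_mono_null (fun x hx => hx.2) h1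
  · push Not at h
    refine ⟨Set.univ, r, hr, by simp, ?_⟩
    intro y _
    exact measure_mono_null (fun x hx => hx.2) (h y)

/-- Codes for null sets. -/
abbrev NullCode : Type := ℕ × TopologicalSpace.countableBasis ℝ → Bool

instance : Countable (TopologicalSpace.countableBasis ℝ) :=
  (TopologicalSpace.countable_countableBasis ℝ).to_subtype

/-- The set coded by a code. -/
def NullCode.set (c : NullCode) : Set ℝ :=
  {y | ∀ m : ℕ, ∃ k : TopologicalSpace.countableBasis ℝ, c (m, k) = true ∧ y ∈ k.1}

lemma exists_nullCode (N : Set ℝ) (hN : volume N = 0) :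
    ∃ c : NullCode, N ⊆ c.set ∧ volume c.set = 0 := by
  classical
  have h : ∀ m : ℕ, ∃ U : Set ℝ, N ⊆ U ∧ IsOpen U ∧ volume U < ((m : ENNReal) + 1)⁻¹ := by
    intro m
    have hlt : volume N < ((m : ENNReal) + 1)⁻¹ := by
      rw [hN]
      exact ENNReal.inv_pos.2 (by finiteness)
    obtain ⟨U, h1, h2, h3⟩ := N.exists_isOpen_lt_of_lt _ hlt
    exact ⟨U, h1, h2, h3⟩
  choose U hNU hU hlt using h
  refine ⟨fun p => decide (p.2.1 ⊆ U p.1), ?_, ?_⟩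
  · intro y hy m
    obtain ⟨v, hv, hyv, hvU⟩ :=
      (TopologicalSpace.isBasis_countableBasis ℝ).exists_subset_of_mem_open (hNU m hy) (hU m)
    exact ⟨⟨v, hv⟩, by simpa using hvU, hyv⟩
  · refine le_antisymm ?_ bot_le
    have hle : ∀ m : ℕ, volume (NullCode.set (fun p => decide (p.2.1 ⊆ U p.1)))
        ≤ ((m : ENNReal) + 1)⁻¹ := by
      intro m
      refine (measure_mono ?_).trans (hlt m).le
      intro y hy
      obtain ⟨k, hk, hyk⟩ := hy m
      have hk' : k.1 ⊆ U m := by simpa using hk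
      exact hk' hyk
    have ht : Filter.Tendsto (fun m : ℕ => ((m : ENNReal) + 1)⁻¹) Filter.atTop (nhds 0) := by
      have := (Filter.tendsto_add_atTop_iff_nat 1).2 ENNReal.tendsto_inv_nat_nhds_zero
      simpa using this
    exact ge_of_tendsto' ht hle

/-- If a family of null sets is coded measurably along `X`, then almost every `y` belongs to
the coded sets only for a null set of `x ∈ X`. -/
lemma ae_null_of_measurable_code (X : Set ℝ) (c : ℝ → NullCode)
    (hc : Measurable (fun x : X => c x)) (hnull : ∀ x ∈ X, volume (c x).set = 0) :
    ∀ᵐ y : ℝ, volume {x | x ∈ X ∧ y ∈ (c x).set} = 0 := by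
  have hB : ∀ p, ∃ B : Set ℝ, MeasurableSet B ∧ ∀ x ∈ X, (x ∈ B ↔ c x p = true) := by
    intro p
    have h1 : MeasurableSet {x : X | c x p = true} :=
      ((measurable_pi_apply p).comp hc) (measurableSet_singleton true)
    obtain ⟨B, hB, hB'⟩ := h1
    refine ⟨B, hB, fun x hx => ?_⟩
    have := Set.ext_iff.1 hB' ⟨x, hx⟩
    simpa using this
  choose B hBm hB using hB
  let G : Set (ℝ × ℝ) := ⋂ m : ℕ, ⋃ k : TopologicalSpace.countableBasis ℝ, B (m, k) ×ˢ k.1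
  have hG : MeasurableSet G := by
    refine MeasurableSet.iInter fun m => MeasurableSet.iUnion fun k => (hBm _).prod ?_
    exact (TopologicalSpace.isOpen_of_mem_countableBasis k.2).measurableSet
  have hsec : ∀ x ∈ X, Prod.mk x ⁻¹' G = (c x).set := by
    intro x hx
    ext y
    simp only [G, Set.mem_preimage, Set.mem_iInter, Set.mem_iUnion, Set.mem_prod, NullCode.set,
      Set.mem_setOf_eq, hB _ x hx]
  let T : Set ℝ := {x | volume (Prod.mk x ⁻¹' G) = 0}
  have hT : MeasurableSet T :=
    (measurable_measure_prodMk_left (ν := (volume : Measure ℝ)) hG) (measurableSet_singleton 0)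
  let G' : Set (ℝ × ℝ) := G ∩ Prod.fst ⁻¹' T
  have hG' : MeasurableSet G' := hG.inter (measurable_fst hT)
  have h0 : ((volume : Measure ℝ).prod (volume : Measure ℝ)) G' = 0 := by
    rw [Measure.measure_prod_null hG']
    refine Filter.Eventually.of_forall fun x => ?_
    by_cases hx : x ∈ T
    · exact measure_mono_null (fun y hy => hy.1) hx
    · have : Prod.mk x ⁻¹' G' = ∅ := by
        ext y
        simp [G', hx]
      simp [this]
  have h1 : ((volume : Measure ℝ).prod (volume : Measure ℝ)) (Prod.swap ⁻¹' G') = 0 := by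
    rw [Measure.measurePreserving_swap.measure_preimage hG'.nullMeasurableSet, h0]
  filter_upwards [Measure.measure_ae_null_of_prod_null h1] with y hy
  refine measure_mono_null ?_ hy
  rintro x ⟨hx, hyx⟩
  have hxT : x ∈ T := by
    change volume _ = 0
    rw [hsec x hx]
    exact hnull x hx
  refine ⟨?_, hxT⟩
  rw [← hsec x hx] at hyx
  exact hyx

/-- Fremlin: There exist a set `Y ⊆ ℝ` of positive outer Lebesgue measure
and a function `f : Y → ℝ` such that for every `X ⊆ Y` of positive outer Lebesgue measure,
the restriction of `f` to `X` (with the subspace topology) is not continuous. -/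
theorem exists_set_and_function_discontinuous_on_every_nonnull_subset :
    ∃ (Y : Set ℝ) (f : Y → ℝ), 0 < volume Y ∧
      ∀ (X : Set ℝ) (hXY : X ⊆ Y), 0 < volume X →
        ¬ Continuous (fun x : X => f (Set.inclusion hXY x)) := by
  obtain ⟨Y, r, hr, hY, hseg⟩ := exists_nonnull_wellOrder
  have hcode : ∀ x : ℝ, ∃ c : NullCode,
      x ∈ Y → {y | y ∈ Y ∧ r y x} ⊆ c.set ∧ volume c.set = 0 := by
    intro x
    by_cases hx : x ∈ Y
    · obtain ⟨c, hc⟩ := exists_nullCode _ (hseg x hx)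
      exact ⟨c, fun _ => hc⟩
    · exact ⟨fun _ => false, fun h => absurd h hx⟩
  choose c hc using hcode
  obtain ⟨e, he⟩ := exists_measurableEmbedding_real NullCode
  refine ⟨Y, fun x => e (c x), hY, ?_⟩
  intro X hXY hX hcont
  have hm : Measurable (fun x : X => c x) := by
    have := hcont.measurable
    exact he.measurable_comp_iff.1 this
  have hae := ae_null_of_measurable_code X c hm (fun x hx => (hc x (hXY hx)).2)
  have hex : ∃ y ∈ Y, volume {x | x ∈ X ∧ y ∈ (c x).set} = 0 := by
    by_contra hno
    push Not at hno
    exact hY.ne' (measure_mono_null (fun y hy => hno y hy) (ae_iff.1 hae))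
  obtain ⟨y, hy, hy0⟩ := hex
  refine hX.ne' (measure_mono_null (t := {x | x ∈ X ∧ y ∈ (c x).set} ∪
    ({x | x ∈ Y ∧ r x y} ∪ {y})) ?_ ?_)
  · intro x hx
    rcases trichotomous_of r x y with h | h | h
    · exact Or.inr (Or.inl ⟨hXY hx, h⟩)
    · exact Or.inr (Or.inr h)
    · exact Or.inl ⟨hx, (hc x (hXY hx)).1 ⟨hy, h⟩⟩
  · exact measure_union_null hy0 (measure_union_null (hseg y hy) (by simp))
end

section
/- Let (N_k)_{k<ω} be a sequence of integers, each an integer power of 2 with N_k ≥ 2. Then the following are equivalent: (3) for every non-measurable set A ⊆ 2^ℕ × 2^ℕ there exists a Borel function f : 2^ℕ → 2^ℕ such that {x ∈ 2^ℕ : (x, f(x)) ∈ A} is not measurable; (4) for every set A ⊆ ∏_{k<ω} N_k × 2^ℕ of outer measure one and inner measure zero, there is a Borel function h : ∏_{k<ω} N_k → 2^ℕ such that the set {x ∈ ∏_{k<ω} N_k : (x, h(x)) ∈ A} is not measurable. -/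
open MeasureTheory

/-- `μ` is the coin-flipping (uniform product) probability measure on `I → Bool`. -/
def IsCoinMeasure {I : Type*} (μ : Measure (I → Bool)) : Prop :=
  ∀ (s : Finset I) (f : I → Bool),
    μ {x | ∀ i ∈ s, x i = f i} = (2 : ENNReal)⁻¹ ^ s.card

/-- `μ` is the square of the coin-flipping measure on `(ℕ → Bool) × (ℕ → Bool)`. -/
def IsCoinMeasure2 (μ : Measure ((ℕ → Bool) × (ℕ → Bool))) : Prop :=
  ∀ (s t : Finset ℕ) (f g : ℕ → Bool),
    μ {z | (∀ i ∈ s, z.1 i = f i) ∧ (∀ j ∈ t, z.2 j = g j)} =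
      (2 : ENNReal)⁻¹ ^ (s.card + t.card)

/-- `μ` is the product over `k` of the uniform probability measures on `Fin (N k)`. -/
def IsUniformPiMeasure (N : ℕ → ℕ) (μ : Measure (Π k, Fin (N k))) : Prop :=
  ∀ (s : Finset ℕ) (f : Π k, Fin (N k)),
    μ {x | ∀ k ∈ s, x k = f k} = ∏ k ∈ s, ((N k : ENNReal))⁻¹

/-- `μ` is the product of the uniform product measure on `Π k, Fin (N k)` with the
coin-flipping measure on `ℕ → Bool`. -/
def IsUniformPiCantorMeasure (N : ℕ → ℕ)
    (μ : Measure ((Π k, Fin (N k)) × (ℕ → Bool))) : Prop :=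
  ∀ (s : Finset ℕ) (f : Π k, Fin (N k)) (t : Finset ℕ) (g : ℕ → Bool),
    μ {z | (∀ k ∈ s, z.1 k = f k) ∧ (∀ j ∈ t, z.2 j = g j)} =
      (∏ k ∈ s, ((N k : ENNReal))⁻¹) * (2 : ENNReal)⁻¹ ^ t.card

/-- Cylinder sets. -/
def cyls {ι : Type*} (X : ι → Type*) : Set (Set (Π i, X i)) :=
  {c | ∃ (s : Finset ι) (f : Π i, X i), c = {x | ∀ i ∈ s, x i = f i}}

lemma isPiSystem_cyls {ι : Type*} (X : ι → Type*) : IsPiSystem (cyls X) := by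
  classical
  rintro _ ⟨s, f, rfl⟩ _ ⟨t, g, rfl⟩ ⟨z, hz1, hz2⟩
  refine ⟨s ∪ t, z, ?_⟩
  ext x
  simp only [Set.mem_inter_iff, Set.mem_ofPred_eq, Finset.mem_union] at *
  constructor
  · rintro ⟨h1, h2⟩ i (hi | hi)
    · rw [h1 i hi, hz1 i hi]
    · rw [h2 i hi, hz2 i hi]
  · intro h
    exact ⟨fun i hi => by rw [h i (Or.inl hi), hz1 i hi],
      fun i hi => by rw [h i (Or.inr hi), hz2 i hi]⟩

lemma generateFrom_cyls {ι : Type*} [Countable ι] (X : ι → Type*) [∀ i, MeasurableSpace (X i)]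
    [∀ i, Countable (X i)] [∀ i, MeasurableSingletonClass (X i)] [∀ i, Nonempty (X i)] :
    MeasurableSpace.generateFrom (cyls X) = MeasurableSpace.pi := by
  classical
  apply le_antisymm
  · apply MeasurableSpace.generateFrom_le
    rintro _ ⟨s, f, rfl⟩
    have : {x : Π i, X i | ∀ i ∈ s, x i = f i} = ⋂ i ∈ s, (fun x => x i) ⁻¹' {f i} := by
      ext; simp
    rw [this]
    exact Finset.measurableSet_biInter _ fun i _ => measurable_pi_apply i (measurableSet_singleton _)
  · refine iSup_le fun i => ?_
    rintro _ ⟨t, _, rfl⟩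
    have : (fun x : Π i, X i => x i) ⁻¹' t =
        ⋃ a ∈ t, {x | ∀ j ∈ ({i} : Finset ι),
          x j = Function.update (fun j => Classical.arbitrary (X j)) i a j} := by
      ext; simp
    change MeasurableSet[MeasurableSpace.generateFrom (cyls X)] ((fun x : Π i, X i => x i) ⁻¹' t)
    rw [this]
    exact MeasurableSet.biUnion t.to_countable fun a _ =>
      MeasurableSpace.measurableSet_generateFrom ⟨_, _, rfl⟩

lemma univ_mem_cyls {ι : Type*} (X : ι → Type*) [∀ i, Nonempty (X i)] :
    Set.univ ∈ cyls X := ⟨∅, fun _ => Classical.arbitrary _, by simp⟩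

/-- Flip the coordinates in `s`. -/
def flips (s : Finset ℕ) (x : ℕ → Bool) : ℕ → Bool := fun i => xor (decide (i ∈ s)) (x i)

lemma flips_flips (s t : Finset ℕ) (x : ℕ → Bool) :
    flips s (flips t x) = flips (symmDiff s t) x := by
  funext i
  simp only [flips, Finset.mem_symmDiff]
  by_cases h1 : i ∈ s <;> by_cases h2 : i ∈ t <;> simp [h1, h2]

lemma flips_self (s : Finset ℕ) (x : ℕ → Bool) : flips s (flips s x) = x := by
  funext i; simp [flips]

lemma measurable_flips (s : Finset ℕ) : Measurable (flips s) := by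
  refine measurable_pi_lambda _ fun i => ?_
  exact (Measurable.of_discrete (f := fun b => xor (decide (i ∈ s)) b)).comp (measurable_pi_apply i)

lemma coin_univ {μ : Measure (ℕ → Bool)} (hμ : IsCoinMeasure μ) : μ Set.univ = 1 := by
  simpa using hμ ∅ (fun _ => true)

lemma flips_preserving {μ : Measure (ℕ → Bool)} (hμ : IsCoinMeasure μ) (s : Finset ℕ) :
    MeasurePreserving (flips s) μ μ := by
  have : IsProbabilityMeasure μ := ⟨coin_univ hμ⟩
  refine ⟨measurable_flips s, ?_⟩
  have := Measure.isProbabilityMeasure_map (μ := μ) (measurable_flips s).aemeasurable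
  refine ext_of_generate_finite _ (generateFrom_cyls (fun _ : ℕ => Bool)).symm
    (isPiSystem_cyls _) ?_ (by simp)
  rintro c ⟨t, f, rfl⟩
  rw [Measure.map_apply (measurable_flips s), hμ t f, ← hμ t (flips s f)]
  · congr 1
    ext x
    simp only [Set.mem_preimage, Set.mem_ofPred_eq, flips]
    refine forall₂_congr fun i _ => ?_
    cases decide (i ∈ s) <;> cases x i <;> cases f i <;> simp
  · rw [← generateFrom_cyls (fun _ : ℕ => Bool)]
    exact MeasurableSpace.measurableSet_generateFrom ⟨_, _, rfl⟩

lemma invariant_unique {μ : Measure (ℕ → Bool)} (hμ : IsCoinMeasure μ)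
    (ρ : Measure (ℕ → Bool)) [IsFiniteMeasure ρ]
    (hρ : ∀ s, ∀ B, MeasurableSet B → ρ (flips s ⁻¹' B) = ρ B) :
    ∀ B, ρ B = ρ Set.univ * μ B := by
  have : IsProbabilityMeasure μ := ⟨coin_univ hμ⟩
  have hms : ∀ (t : Finset ℕ) (f : ℕ → Bool), MeasurableSet {x : ℕ → Bool | ∀ i ∈ t, x i = f i} := by
    intro t f
    rw [← generateFrom_cyls (fun _ : ℕ => Bool)]
    exact MeasurableSpace.measurableSet_generateFrom ⟨_, _, rfl⟩
  have key : ρ = ρ Set.univ • μ := by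
    have : IsFiniteMeasure (ρ Set.univ • μ) := Measure.smul_finite _ (measure_ne_top _ _)
    refine ext_of_generate_finite _ (generateFrom_cyls (fun _ : ℕ => Bool)).symm
      (isPiSystem_cyls _) ?_ (by simp)
    rintro c ⟨t, f, rfl⟩
    rw [Measure.smul_apply, hμ t f, smul_eq_mul]
    induction t using Finset.induction_on with
    | empty => simp
    | insert a t ha ih =>
      have h1 := measure_inter_add_sdiff (μ := ρ) {x : ℕ → Bool | ∀ i ∈ t, x i = f i} (hms {a} f)
      have e1 : {x : ℕ → Bool | ∀ i ∈ t, x i = f i} ∩ {x | ∀ i ∈ ({a} : Finset ℕ), x i = f i}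
          = {x | ∀ i ∈ insert a t, x i = f i} := by
        ext x; simp [and_comm]
      have e2 : {x : ℕ → Bool | ∀ i ∈ t, x i = f i} \ {x | ∀ i ∈ ({a} : Finset ℕ), x i = f i}
          = flips {a} ⁻¹' {x | ∀ i ∈ insert a t, x i = f i} := by
        ext x
        simp only [Set.mem_sdiff, Set.mem_ofPred_eq, Finset.mem_singleton, forall_eq,
          Set.mem_preimage, Finset.forall_mem_insert, flips]
        rw [and_comm]
        refine and_congr ?_ (forall₂_congr fun i hi => ?_)
        · cases x a <;> cases f a <;> simp
        · have : i ≠ a := fun h => ha (h ▸ hi)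
          simp [this]
      rw [e1, e2, hρ _ _ (hms _ _), ih, ← two_mul] at h1
      rw [Finset.card_insert_of_notMem ha, pow_succ, ← mul_assoc, ← h1, mul_comm, ← mul_assoc,
        ENNReal.inv_mul_cancel (by simp) (by simp), one_mul]
  intro B
  conv_lhs => rw [key]
  simp

/-- Product flips. -/
def flips2 (g : Finset ℕ × Finset ℕ) (z : (ℕ → Bool) × (ℕ → Bool)) : (ℕ → Bool) × (ℕ → Bool) :=
  (flips g.1 z.1, flips g.2 z.2)

lemma flips2_self (g : Finset ℕ × Finset ℕ) (z) : flips2 g (flips2 g z) = z := by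
  simp [flips2, flips_self]

lemma flips2_preserving {μ : Measure (ℕ → Bool)} (hμ : IsCoinMeasure μ)
    (g : Finset ℕ × Finset ℕ) : MeasurePreserving (flips2 g) (μ.prod μ) (μ.prod μ) := by
  have : IsProbabilityMeasure μ := ⟨coin_univ hμ⟩
  exact (flips_preserving hμ g.1).prod (flips_preserving hμ g.2)

lemma ergodic_flips2 {μ : Measure (ℕ → Bool)} (hμ : IsCoinMeasure μ)
    (F : Set ((ℕ → Bool) × (ℕ → Bool))) (hF : MeasurableSet F)
    (hinv : ∀ g, flips2 g ⁻¹' F = F) (hpos : μ.prod μ F ≠ 0) : μ.prod μ Fᶜ = 0 := by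
  have : IsProbabilityMeasure μ := ⟨coin_univ hμ⟩
  set ρ := (μ.prod μ).restrict F with hρ
  have hρinv : ∀ g B, MeasurableSet B → ρ (flips2 g ⁻¹' B) = ρ B := by
    intro g B hB
    rw [hρ, Measure.restrict_apply hB, Measure.restrict_apply ((flips2_preserving hμ g).measurable hB),
      ← (flips2_preserving hμ g).measure_preimage (hB.inter hF).nullMeasurableSet,
      Set.preimage_inter, hinv]
  have h0 : flips ∅ = id := by funext x i; simp [flips]
  have hs : ∀ D, MeasurableSet D → ρ (Set.univ ×ˢ D) = ρ Set.univ * μ D := by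
    intro D hD
    have := invariant_unique hμ (ρ.map Prod.snd) (fun s B hB => by
      rw [Measure.map_apply measurable_snd (measurable_flips s hB),
        Measure.map_apply measurable_snd hB, ← hρinv (∅, s) _ (measurable_snd hB)]
      rfl) D
    rw [Measure.map_apply measurable_snd hD, Measure.map_apply measurable_snd .univ] at this
    rw [Set.univ_prod]; exact this
  have hr : ∀ C D, MeasurableSet C → MeasurableSet D → ρ (C ×ˢ D) = ρ Set.univ * (μ C * μ D) := by
    intro C D hC hD
    have hUD : MeasurableSet ((Set.univ : Set (ℕ → Bool)) ×ˢ D) := MeasurableSet.univ.prod hD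
    have := invariant_unique hμ ((ρ.restrict (Set.univ ×ˢ D)).map Prod.fst) (fun s B hB => by
      rw [Measure.map_apply measurable_fst (measurable_flips s hB),
        Measure.map_apply measurable_fst hB, Measure.restrict_apply (measurable_fst hB),
        Measure.restrict_apply (measurable_fst (measurable_flips s hB)),
        ← hρinv (s, ∅) _ ((measurable_fst hB).inter hUD)]
      congr 1
      ext z
      simp [flips2, h0]) C
    rw [Measure.map_apply measurable_fst hC, Measure.map_apply measurable_fst .univ,
      Measure.restrict_apply (measurable_fst hC), Set.preimage_univ,
      Measure.restrict_apply .univ, Set.univ_inter, hs D hD] at this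
    have e : C ×ˢ D = Prod.fst ⁻¹' C ∩ Set.univ ×ˢ D := by ext; simp
    rw [e, this]; ring
  have hfin : ρ Set.univ ≠ ⊤ := measure_ne_top _ _
  have hne : ρ Set.univ ≠ 0 := by rw [hρ, Measure.restrict_apply_univ]; exact hpos
  have heq : μ.prod μ = (ρ Set.univ)⁻¹ • ρ := by
    refine Measure.prod_eq fun C D hC hD => ?_
    rw [Measure.smul_apply, smul_eq_mul, hr C D hC hD, ← mul_assoc, ENNReal.inv_mul_cancel hne hfin,
      one_mul]
  rw [heq, Measure.smul_apply, hρ, Measure.restrict_apply hF.compl]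
  simp

lemma eq_prod {ι κ : Type*} [Countable ι] [Countable κ] (X : ι → Type*) (Y : κ → Type*)
    [∀ i, MeasurableSpace (X i)] [∀ i, Countable (X i)] [∀ i, MeasurableSingletonClass (X i)]
    [∀ i, Nonempty (X i)]
    [∀ i, MeasurableSpace (Y i)] [∀ i, Countable (Y i)] [∀ i, MeasurableSingletonClass (Y i)]
    [∀ i, Nonempty (Y i)]
    (μ : Measure (Π i, X i)) (ν : Measure (Π i, Y i)) [IsFiniteMeasure μ] [IsFiniteMeasure ν]
    (ρ : Measure ((Π i, X i) × (Π i, Y i)))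
    (h : ∀ (s : Finset ι) (f : Π i, X i) (t : Finset κ) (g : Π i, Y i),
      ρ {z | (∀ i ∈ s, z.1 i = f i) ∧ (∀ j ∈ t, z.2 j = g j)} =
        μ {x | ∀ i ∈ s, x i = f i} * ν {x | ∀ i ∈ t, x i = g i}) :
    μ.prod ν = ρ := by
  refine Measure.prod_eq_generateFrom (generateFrom_cyls X) (generateFrom_cyls Y)
    (isPiSystem_cyls X) (isPiSystem_cyls Y)
    ⟨fun _ => Set.univ, fun _ => univ_mem_cyls X, fun _ => measure_lt_top _ _, Set.iUnion_const _⟩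
    ⟨fun _ => Set.univ, fun _ => univ_mem_cyls Y, fun _ => measure_lt_top _ _, Set.iUnion_const _⟩ ?_
  rintro _ ⟨s, f, rfl⟩ _ ⟨t, g, rfl⟩
  exact h s f t g

lemma exists_iso (N : ℕ → ℕ) (hNpow : ∀ k, ∃ m : ℕ, N k = 2 ^ m) (hN2 : ∀ k, 2 ≤ N k)
    (μ : Measure (ℕ → Bool)) (hμ : IsCoinMeasure μ)
    (ν : Measure (Π k, Fin (N k)))
    (hν : ∀ (s : Finset ℕ) (f : Π k, Fin (N k)),
      ν {x | ∀ k ∈ s, x k = f k} = ∏ k ∈ s, ((N k : ENNReal))⁻¹) :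
    ∃ Φ : (ℕ → Bool) ≃ᵐ (Π k, Fin (N k)), MeasurePreserving Φ μ ν := by
  classical
  have : IsProbabilityMeasure μ := ⟨coin_univ hμ⟩
  have hne : ∀ k, Nonempty (Fin (N k)) := fun k => ⟨⟨0, by have := hN2 k; omega⟩⟩
  have : IsProbabilityMeasure ν := ⟨by simpa using hν ∅ (fun k => (hne k).some)⟩
  choose m hm using hNpow
  have hm1 : ∀ k, 0 < m k := by
    intro k
    rcases Nat.eq_zero_or_pos (m k) with h | h
    · have := hN2 k; rw [hm k, h] at this; norm_num at this
    · exact h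
  have c : ∀ k, Fin (N k) ≃ (Fin (m k) → Bool) := fun k =>
    Fintype.equivOfCardEq (by simp [hm k])
  have : Infinite (Σ k, Fin (m k)) :=
    Infinite.of_injective (fun k => (⟨k, ⟨0, hm1 k⟩⟩ : Σ k, Fin (m k)))
      (fun a b h => congrArg Sigma.fst h)
  obtain ⟨e⟩ : Nonempty ((Σ k, Fin (m k)) ≃ ℕ) := nonempty_equiv_of_countable
  have hec : ∀ (y : Π k, Fin (N k)) (k : ℕ) (j : Fin (m k)),
      c (e.symm (e ⟨k, j⟩)).1 (y (e.symm (e ⟨k, j⟩)).1) (e.symm (e ⟨k, j⟩)).2 = c k (y k) j := by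
    intro y k j
    have : ∀ p q : Σ k, Fin (m k), p = q → c p.1 (y p.1) p.2 = c q.1 (y q.1) q.2 := by
      rintro p q rfl; rfl
    exact this _ ⟨k, j⟩ (e.symm_apply_apply _)
  let Φ : (ℕ → Bool) ≃ᵐ (Π k, Fin (N k)) :=
    { toFun := fun x k => (c k).symm (fun j => x (e ⟨k, j⟩))
      invFun := fun y n => c (e.symm n).1 (y (e.symm n).1) (e.symm n).2
      left_inv := fun x => by funext n; simp
      right_inv := fun y => by funext k; simp only [hec]; exact (c k).symm_apply_apply _
      measurable_toFun := by
        refine measurable_pi_lambda _ fun k => ?_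
        exact (Measurable.of_discrete (f := (c k).symm)).comp
          (measurable_pi_lambda _ fun j => measurable_pi_apply _)
      measurable_invFun := by
        refine measurable_pi_lambda _ fun n => ?_
        exact (Measurable.of_discrete
          (f := fun a => c (e.symm n).1 a (e.symm n).2)).comp (measurable_pi_apply _) }
  refine ⟨Φ, Φ.measurable, ?_⟩
  have := Measure.isProbabilityMeasure_map (μ := μ) Φ.measurable.aemeasurable
  refine ext_of_generate_finite _ (generateFrom_cyls (fun k => Fin (N k))).symm
    (isPiSystem_cyls _) ?_ (by simp)
  rintro _ ⟨s, f, rfl⟩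
  rw [Φ.map_apply, hν]
  have h1 : Φ ⁻¹' {x | ∀ i ∈ s, x i = f i} =
      {x | ∀ n ∈ (s.sigma fun k => (Finset.univ : Finset (Fin (m k)))).map e.toEmbedding,
        x n = Φ.symm f n} := by
    ext x
    have : ∀ k, Φ x k = f k ↔ ∀ j, x (e ⟨k, j⟩) = Φ.symm f (e ⟨k, j⟩) := by
      intro k
      change (c k).symm (fun j => x (e ⟨k, j⟩)) = f k ↔ ∀ j, x (e ⟨k, j⟩) =
        c (e.symm (e ⟨k, j⟩)).1 (f (e.symm (e ⟨k, j⟩)).1) (e.symm (e ⟨k, j⟩)).2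
      rw [Equiv.symm_apply_eq, funext_iff]
      simp only [hec]
    simp only [Set.mem_preimage, Set.mem_ofPred_eq, this, Finset.mem_map, Finset.mem_sigma,
      Finset.mem_univ, and_true]
    constructor
    · rintro h n ⟨⟨k, j⟩, hk, rfl⟩
      exact h k hk j
    · intro h k hk j
      exact h _ ⟨⟨k, j⟩, hk, rfl⟩
  rw [h1, hμ, Finset.card_map, Finset.card_sigma, ← Finset.prod_pow_eq_pow_sum]
  refine Finset.prod_congr rfl fun k _ => ?_
  simp [hm k, ENNReal.inv_pow]

/-- for a sequence `N` of powers of two with `N k ≥ 2`, condition (3)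
(about `2^ℕ × 2^ℕ`) is equivalent to condition (4) (about `(Π k, Fin (N k)) × 2^ℕ` and
sets of outer measure one and inner measure zero). -/
theorem cantor_graph_condition_iff_pi_graph_condition
    (N : ℕ → ℕ) (hNpow : ∀ k, ∃ m : ℕ, N k = 2 ^ m) (hN2 : ∀ k, 2 ≤ N k)
    (μ : Measure (ℕ → Bool)) (hμ : IsCoinMeasure μ)
    (μ₂ : Measure ((ℕ → Bool) × (ℕ → Bool))) (hμ₂ : IsCoinMeasure2 μ₂)
    (ν : Measure (Π k, Fin (N k))) (hν : IsUniformPiMeasure N ν)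
    (ν₂ : Measure ((Π k, Fin (N k)) × (ℕ → Bool))) (hν₂ : IsUniformPiCantorMeasure N ν₂) :
    (∀ A : Set ((ℕ → Bool) × (ℕ → Bool)), ¬ NullMeasurableSet A μ₂ →
      ∃ f : (ℕ → Bool) → (ℕ → Bool), Measurable f ∧
        ¬ NullMeasurableSet {x : ℕ → Bool | (x, f x) ∈ A} μ) ↔
    (∀ A : Set ((Π k, Fin (N k)) × (ℕ → Bool)),
      (∀ B, A ⊆ B → MeasurableSet B → ν₂ B = 1) →
      (∀ B, B ⊆ A → MeasurableSet B → ν₂ B = 0) →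
      ∃ h : (Π k, Fin (N k)) → (ℕ → Bool), Measurable h ∧
        ¬ NullMeasurableSet {x : Π k, Fin (N k) | (x, h x) ∈ A} ν) := by
  classical
  have hμp : IsProbabilityMeasure μ := ⟨coin_univ hμ⟩
  have hne : ∀ k, Nonempty (Fin (N k)) := fun k => ⟨⟨0, by have := hN2 k; omega⟩⟩
  have hνp : IsProbabilityMeasure ν := ⟨by simpa using hν ∅ (fun k => (hne k).some)⟩
  obtain rfl : μ.prod μ = μ₂ := eq_prod _ _ μ μ μ₂ fun s f t g => by
    rw [hμ s f, hμ t g, hμ₂ s t f g, pow_add]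
  obtain rfl : ν.prod μ = ν₂ := eq_prod _ _ ν μ ν₂ fun s f t g => by
    rw [hν s f, hμ t g, hν₂ s f t g]
  obtain ⟨Φ, hΦ⟩ := exists_iso N hNpow hN2 μ hμ ν hν
  have hΦs : MeasurePreserving Φ.symm ν μ := hΦ.symm Φ
  have hΨ : MeasurePreserving (Prod.map Φ id) (μ.prod μ) (ν.prod μ) :=
    hΦ.prod (MeasurePreserving.id μ)
  have hΨs : MeasurePreserving (Prod.map Φ.symm id) (ν.prod μ) (μ.prod μ) :=
    hΦs.prod (MeasurePreserving.id μ)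
  constructor
  · intro h3 A hout hin
    have hA : ¬ NullMeasurableSet A (ν.prod μ) := by
      intro hA
      obtain ⟨B, hBA, hB, hBe⟩ := hA.exists_measurable_superset_ae_eq
      obtain ⟨C, hCA, hC, hCe⟩ := hA.exists_measurable_subset_ae_eq
      have h1 := hout B hBA hB
      have h2 := hin C hCA hC
      rw [measure_congr hBe] at h1
      rw [measure_congr hCe, h1] at h2
      exact one_ne_zero h2
    obtain ⟨f, hf, hfA⟩ := h3 (Prod.map Φ id ⁻¹' A) (fun h => hA (by
      have := h.preimage hΨs.quasiMeasurePreserving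
      rw [← Set.preimage_comp] at this
      convert this
      ext z; simp [Prod.map]))
    refine ⟨f ∘ Φ.symm, hf.comp Φ.symm.measurable, fun h => hfA ?_⟩
    have := h.preimage hΦ.quasiMeasurePreserving
    convert this using 1
    ext x; simp
  · intro h4 A hA
    by_contra hcon
    push Not at hcon
    set H := toMeasurable (μ.prod μ) A with hH
    set L := toMeasurable (μ.prod μ) Aᶜ with hL
    have hHm : MeasurableSet H := measurableSet_toMeasurable _ _
    have hLm : MeasurableSet L := measurableSet_toMeasurable _ _
    have hAH : A ⊆ H := subset_toMeasurable _ _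
    have hAL : Aᶜ ⊆ L := subset_toMeasurable _ _
    set E := H ∩ L with hE
    have hEm : MeasurableSet E := hHm.inter hLm
    have hEpos : μ.prod μ E ≠ 0 := by
      intro h0
      apply hA
      refine ⟨H, hHm, ?_⟩
      refine Filter.EventuallyLE.antisymm (LE.le.eventuallyLE hAH) ?_
      rw [ae_le_set]
      have hsub : H \ A ⊆ E := fun z hz => ⟨hz.1, hAL hz.2⟩
      exact measure_mono_null hsub h0
    have hin : ∀ B, MeasurableSet B → B ⊆ E → B ⊆ A → μ.prod μ B = 0 := by
      intro B hB hBE hBA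
      have := Measure.measure_toMeasurable_inter (μ := μ.prod μ) (t := Aᶜ) hB (measure_ne_top _ _)
      rw [← hL, Set.inter_eq_right.2 (fun z hz => (hBE hz).2)] at this
      rw [this, Set.disjoint_iff_inter_eq_empty.1 (Set.disjoint_compl_left_iff_subset.2 hBA)]
      simp
    have hout : ∀ B, MeasurableSet B → B ⊆ E → B ⊆ Aᶜ → μ.prod μ B = 0 := by
      intro B hB hBE hBA
      have := Measure.measure_toMeasurable_inter (μ := μ.prod μ) (t := A) hB (measure_ne_top _ _)
      rw [← hH, Set.inter_eq_right.2 (fun z hz => (hBE hz).1)] at this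
      rw [this, Set.disjoint_iff_inter_eq_empty.1 (Set.subset_compl_iff_disjoint_left.1 hBA)]
      simp
    obtain ⟨d, hd⟩ := exists_surjective_nat (Finset ℕ × Finset ℕ)
    have hTm : ∀ g, Measurable (flips2 g) := fun g => (flips2_preserving hμ g).measurable
    set U : ℕ → Set ((ℕ → Bool) × (ℕ → Bool)) := fun n => flips2 (d n) ⁻¹' E with hU
    have hUm : ∀ n, MeasurableSet (U n) := fun n => hTm _ hEm
    have hDm : ∀ n, MeasurableSet (disjointed U n) := MeasurableSet.disjointed hUm
    have hDU : ∀ n, disjointed U n ⊆ U n := fun n => disjointed_le U n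
    have hF0 : μ.prod μ (⋃ n, U n)ᶜ = 0 := by
      refine ergodic_flips2 hμ _ (MeasurableSet.iUnion hUm) ?_ ?_
      · have hmem : ∀ z, z ∈ ⋃ n, U n ↔ ∃ g, flips2 g z ∈ E := by
          intro z
          rw [Set.mem_iUnion, hd.exists]
          rfl
        have hsub : ∀ g z, flips2 g z ∈ ⋃ n, U n → z ∈ ⋃ n, U n := by
          intro g z hz
          obtain ⟨g', hg'⟩ := (hmem _).1 hz
          refine (hmem _).2 ⟨(symmDiff g'.1 g.1, symmDiff g'.2 g.2), ?_⟩
          simpa [flips2, flips_flips] using hg'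
        intro g
        refine Set.Subset.antisymm (fun z hz => hsub g z hz) (fun z hz => hsub g _ ?_)
        rwa [flips2_self]
      · intro h0
        have := measure_mono_null (Set.subset_iUnion U 0) h0
        rw [hU, (flips2_preserving hμ _).measure_preimage hEm.nullMeasurableSet] at this
        exact hEpos this
    -- a measurable set which is null on each piece is null
    have hpieces : ∀ B, (∀ n, μ.prod μ (B ∩ disjointed U n) = 0) → μ.prod μ B = 0 := by
      intro B hB
      refine measure_mono_null ?_ (measure_union_null hF0 (measure_iUnion_null hB))
      intro z hz
      by_cases h : z ∈ ⋃ n, U n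
      · right
        rw [← iUnion_disjointed, Set.mem_iUnion] at h
        obtain ⟨n, hn⟩ := h
        exact Set.mem_iUnion.2 ⟨n, hz, hn⟩
      · exact Or.inl h
    set A' := ⋃ n, (flips2 (d n) ⁻¹' A ∩ disjointed U n) with hA'
    have hA'n : ∀ n z, z ∈ disjointed U n → (z ∈ A' ↔ flips2 (d n) z ∈ A) := by
      intro n z hz
      rw [hA', Set.mem_iUnion]
      constructor
      · rintro ⟨k, hk, hk'⟩
        have : k = n := by
          by_contra hkn
          exact Set.disjoint_left.1 (disjoint_disjointed U hkn) hk' hz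
        subst this
        exact hk
      · intro h
        exact ⟨n, h, hz⟩
    have hA'in : ∀ B, MeasurableSet B → B ⊆ A' → μ.prod μ B = 0 := by
      intro B hB hBA
      refine hpieces B fun n => ?_
      rw [← (flips2_preserving hμ (d n)).measure_preimage (hB.inter (hDm n)).nullMeasurableSet]
      refine hin _ (hTm _ (hB.inter (hDm n))) ?_ ?_
      · intro z hz
        have := hDU n hz.2
        rw [hU] at this
        simpa [flips2_self] using this
      · intro z hz
        have := (hA'n n _ hz.2).1 (hBA hz.1)
        rwa [flips2_self] at this
    have hA'out : ∀ B, MeasurableSet B → B ⊆ A'ᶜ → μ.prod μ B = 0 := by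
      intro B hB hBA
      refine hpieces B fun n => ?_
      rw [← (flips2_preserving hμ (d n)).measure_preimage (hB.inter (hDm n)).nullMeasurableSet]
      refine hout _ (hTm _ (hB.inter (hDm n))) ?_ ?_
      · intro z hz
        have := hDU n hz.2
        rw [hU] at this
        simpa [flips2_self] using this
      · intro z hz hzA
        refine hBA hz.1 ((hA'n n _ hz.2).2 ?_)
        rwa [flips2_self]
    obtain ⟨h, hh, hhA⟩ := h4 (Prod.map Φ.symm id ⁻¹' A') (by
      intro B hAB hB
      rw [← prob_compl_eq_zero_iff hB, ← hΨ.measure_preimage hB.compl.nullMeasurableSet]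
      refine hA'out _ (hΨ.measurable hB.compl) fun z hz hzA => hz (hAB ?_)
      simpa [Prod.map] using hzA) (by
      intro B hBA hB
      rw [← hΨ.measure_preimage hB.nullMeasurableSet]
      refine hA'in _ (hΨ.measurable hB) fun z hz => ?_
      simpa [Prod.map] using hBA hz)
    apply hhA
    have key : NullMeasurableSet {x | (x, h (Φ x)) ∈ A'} μ := by
      have hh' : Measurable fun x => h (Φ x) := hh.comp Φ.measurable
      have e : {x | (x, h (Φ x)) ∈ A'} = ⋃ n, (flips (d n).1 ⁻¹'
          {u | (u, flips (d n).2 (h (Φ (flips (d n).1 u)))) ∈ A} ∩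
          (fun x => (x, h (Φ x))) ⁻¹' disjointed U n) := by
        ext x
        simp [hA', flips2, flips_self]
      rw [e]
      refine NullMeasurableSet.iUnion fun n => NullMeasurableSet.inter ?_ ?_
      · refine NullMeasurableSet.preimage ?_ (flips_preserving hμ _).quasiMeasurePreserving
        exact hcon _ ((measurable_flips _).comp (hh'.comp (measurable_flips _)))
      · exact ((measurable_id.prodMk hh') (hDm n)).nullMeasurableSet
    have := key.preimage hΦs.quasiMeasurePreserving
    convert this using 1
    ext y; simp
end

section
/- Let p ∈ Q^mt_4(K,Σ,F) be a normal condition with μ^F(p) > 1/2 and nor[t^p_η] > 2 for all η ∈ T^p, let k₀ = lh(root(T^p)) > 4, and let 0 < ε ≤ 2^(−(1+k₀)). Suppose B is an antichain of T^p (a set of pairwise ⊴-incomparable nodes of T^p), and for each ν ∈ B a normal condition q_ν ∈ Q^mt_4(K,Σ,F) is given with p^{[ν]} ≤ q_ν, root(T^{q_ν}) = ν, and μ^F(q_ν) ≥ 1 − ε. Then at least one of the following holds: (i) there is a normal condition q ∈ Q^mt_4(K,Σ,F) with p ≤ q, root(T^q) = root(T^p), and T^q ∩ B = ∅; (ii)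 there is a normal condition q ∈ Q^mt_4(K,Σ,F) such that p ≤ q, root(T^q) = root(T^p), μ^F(q) ≥ (1 − 2^(−k₀))·μ^F(p), T^q ∩ B is a front of T^q, q^{[ν]} = q_ν for every ν ∈ T^q ∩ B, and whenever η ∈ T^q satisfies η ⊲ ν for some ν ∈ B, then nor[t^q_η] ≥ nor[t^p_η] − 2. -/
namespace MeasuredTrees

/-- `η` is a valid node for `H`: a finite sequence with `η i ∈ H i` for all `i < lh η`. -/
def ValidNode (H : ℕ → Finset ℕ) (η : List ℕ) : Prop :=
  ∀ (i : ℕ) (h : i < η.length), η.get ⟨i, h⟩ ∈ H i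

/-- A local tree-creature for `H`: a node `η_t`, a nonnegative norm, and a nonempty set
`pos(t)` of nodes of length `lh(η_t)+1` properly extending `η_t`. -/
structure TCreature (H : ℕ → Finset ℕ) where
  node : List ℕ
  node_ok : ValidNode H node
  nor : ℝ
  nor_nonneg : 0 ≤ nor
  pos : Finset (List ℕ)
  pos_ne : pos.Nonempty
  pos_ok : ∀ ν ∈ pos, node <+: ν ∧ ν.length = node.length + 1 ∧ ValidNode H ν

/-- A measured tree creating triple `(K, Σ, F)` for `H` (data part). -/
structure MTriple (H : ℕ → Finset ℕ) where
  K : Set (TCreature H)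
  Sig : TCreature H → Set (TCreature H)
  F : TCreature H → (List ℕ → ℝ) → ℝ

variable {H : ℕ → Finset ℕ}

/-- The structural requirements: `(K,Σ)` is a strongly finitary local tree-creating
pair, each `H m` has at least two elements, and each `F t` is a map
`[0,1]^{pos t} → [0,1]` (represented on total functions, depending only on the
values on `pos t`). -/
structure MTriple.Good (T : MTriple H) : Prop where
  H_two : ∀ m : ℕ, 2 ≤ (H m).card
  sig_mem : ∀ t ∈ T.K, T.Sig t ⊆ T.K
  sig_node : ∀ t s : TCreature H, s ∈ T.Sig t → s.node = t.node
  sig_pos : ∀ t s : TCreature H, s ∈ T.Sig t → s.pos ⊆ t.pos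
  sig_trans : ∀ t s : TCreature H, s ∈ T.Sig t → T.Sig s ⊆ T.Sig t
  finitary : ∀ η : List ℕ, {t : TCreature H | t ∈ T.K ∧ t.node = η}.Finite
  F_congr : ∀ (t : TCreature H) (r r' : List ℕ → ℝ),
    (∀ ν ∈ t.pos, r ν = r' ν) → T.F t r = T.F t r'
  F_mem : ∀ (t : TCreature H) (r : List ℕ → ℝ),
    (∀ ν ∈ t.pos, r ν ∈ Set.Icc (0 : ℝ) 1) → T.F t r ∈ Set.Icc (0 : ℝ) 1

/-- The triple is nice: monotonicity (α), splitting (β), homogeneity (γ) and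
approximation (δ). -/
structure MTriple.Nice (T : MTriple H) : Prop where
  mono : ∀ t ∈ T.K, ∀ r r' : List ℕ → ℝ,
    (∀ ν ∈ t.pos, r ν ∈ Set.Icc (0 : ℝ) 1) → (∀ ν ∈ t.pos, r' ν ∈ Set.Icc (0 : ℝ) 1) →
    (∀ ν ∈ t.pos, r ν ≤ r' ν) → T.F t r ≤ T.F t r'
  split : ∀ t ∈ T.K, 1 < t.nor →
    ∀ r r0 r1 : List ℕ → ℝ,
    (∀ ν ∈ t.pos, r ν ∈ Set.Icc (0 : ℝ) 1 ∧ r0 ν ∈ Set.Icc (0 : ℝ) 1 ∧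
      r1 ν ∈ Set.Icc (0 : ℝ) 1) →
    (∀ ν ∈ t.pos, r ν ≤ r0 ν + r1 ν) →
    ((2 : ℝ) ^ (2 ^ t.node.length))⁻¹ ≤ T.F t r →
    ∃ c0 c1 : ℝ, ∃ s0 s1 : TCreature H, s0 ∈ T.Sig t ∧ s1 ∈ T.Sig t ∧
      c0 + c1 = (1 - ((2 : ℝ) ^ (2 ^ t.node.length))⁻¹) * T.F t r ∧
      (0 < c0 → t.nor - 1 ≤ s0.nor ∧ (∀ ν ∈ s0.pos, 0 < r0 ν) ∧ c0 ≤ T.F s0 r0) ∧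
      (0 < c1 → t.nor - 1 ≤ s1.nor ∧ (∀ ν ∈ s1.pos, 0 < r1 ν) ∧ c1 ≤ T.F s1 r1)
  scale : ∀ t ∈ T.K, ∀ b : ℝ, b ∈ Set.Icc (0 : ℝ) 1 →
    ∀ r : List ℕ → ℝ, (∀ ν ∈ t.pos, r ν ∈ Set.Icc (0 : ℝ) 1) →
    T.F t (fun ν => b * r ν) = b * T.F t r
  approx : ∀ t ∈ T.K, ∀ r : List ℕ → ℝ, (∀ ν ∈ t.pos, r ν ∈ Set.Icc (0 : ℝ) 1) →
    ∀ ε : ℝ, 0 < ε →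
    ∃ r' : List ℕ → ℝ, (∀ ν ∈ t.pos, r ν < r' ν) ∧
      ∀ r'' : List ℕ → ℝ, (∀ ν ∈ t.pos, r'' ν ∈ Set.Icc (0 : ℝ) 1) →
        (∀ ν ∈ t.pos, r ν ≤ r'' ν ∧ r'' ν < r' ν) → T.F t r'' < T.F t r + ε

/-- A condition of `Q^tree_∅(K,Σ)`: a tree of nodes with no maximal elements,
together with a creature of `K` at every node whose possibilities are exactly the
successors in the tree. -/
structure Cond (T : MTriple H) where
  tree : Set (List ℕ)
  root : List ℕ
  root_mem : root ∈ tree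
  root_le : ∀ η ∈ tree, root <+: η
  closed : ∀ η ∈ tree, ∀ ν : List ℕ, root <+: ν → ν <+: η → ν ∈ tree
  c : List ℕ → TCreature H
  c_mem : ∀ η ∈ tree, c η ∈ T.K
  c_node : ∀ η ∈ tree, (c η).node = η
  succ_eq : ∀ η ∈ tree, ∀ ν : List ℕ,
    ((ν ∈ tree ∧ η <+: ν ∧ ν.length = η.length + 1) ↔ ν ∈ (c η).pos)

variable {T : MTriple H}

/-- The initial segment of length `n` of an infinite sequence. -/
def initSeg (x : ℕ → ℕ) (n : ℕ) : List ℕ := (List.range n).map x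

/-- `x` is an ω-branch of the tree of `p` through the node `η`. -/
def IsBranchAt (p : Cond T) (η : List ℕ) (x : ℕ → ℕ) : Prop :=
  initSeg x η.length = η ∧ ∀ n : ℕ, η.length ≤ n → initSeg x n ∈ p.tree

/-- `A` is a front of the tree of `p^{[η]}`: a set of nodes of the tree extending `η`
met by every ω-branch through `η`. -/
def IsFrontAt (p : Cond T) (η : List ℕ) (A : Set (List ℕ)) : Prop :=
  (∀ ρ ∈ A, ρ ∈ p.tree ∧ η <+: ρ) ∧
  ∀ x : ℕ → ℕ, IsBranchAt p η x → ∃ n : ℕ, initSeg x n ∈ A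

/-- `ρ ∈ T[p^{[η]}, A]`, i.e. `ρ` is a node of the tree of `p` extending `η` and lying
(weakly) below some member of `A`. -/
def InCone (p : Cond T) (η : List ℕ) (A : Set (List ℕ)) (ρ : List ℕ) : Prop :=
  ρ ∈ p.tree ∧ η <+: ρ ∧ ∃ ν ∈ A, ρ <+: ν

/-- `m` is the function `μ^f_{p^{[η]},A}` (extended by `0` off `T[p^{[η]},A]`):
it equals `f` on `A` and satisfies the downward recursion
`m ρ = F_{t^p_ρ}(m ν : ν ∈ pos(t^p_ρ))` on `T[p^{[η]},A] ∖ A`. -/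
def IsMuAt (p : Cond T) (η : List ℕ) (A : Set (List ℕ))
    (f : List ℕ → ℝ) (m : List ℕ → ℝ) : Prop :=
  (∀ ρ ∈ A, m ρ = f ρ) ∧
  (∀ ρ : List ℕ, InCone p η A ρ → ρ ∉ A → m ρ = T.F (p.c ρ) m) ∧
  (∀ ρ : List ℕ, ¬ InCone p η A ρ → m ρ = 0)

/-- `μ^F_p(η)`: the infimum over fronts `A` of `p^{[η]}` of `μ^{1_A}_{p^{[η]},A}(η)`. -/
noncomputable def muAt (p : Cond T) (η : List ℕ) : ℝ :=
  sInf {x : ℝ | ∃ (A : Set (List ℕ)) (m : List ℕ → ℝ),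
    IsFrontAt p η A ∧ IsMuAt p η A (fun _ => 1) m ∧ x = m η}

/-- `μ^F(p) = μ^F_p(root p)`. -/
noncomputable def muF (p : Cond T) : ℝ := muAt p p.root

/-- The norm condition (c)₄ defining `Q^tree_4(K,Σ)` : for every `n` the set of nodes
above which all norms are at least `n` contains a front. -/
def Qtree4 (p : Cond T) : Prop :=
  ∀ n : ℕ, ∃ A : Set (List ℕ), IsFrontAt p p.root A ∧
    ∀ ν ∈ A, ∀ ρ ∈ p.tree, ν <+: ρ → (n : ℝ) ≤ (p.c ρ).nor

/-- The order on conditions: `p ≤ q` iff the tree of `q` is contained in that of `p`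
and each creature of `q` belongs to `Σ` of the corresponding creature of `p`. -/
def CondLe (p q : Cond T) : Prop :=
  q.tree ⊆ p.tree ∧ ∀ η ∈ q.tree, q.c η ∈ T.Sig (p.c η)

/-- `p` is normal: `μ^F_p(η) > 0` for every node `η` of the tree of `p`. -/
def Normal (p : Cond T) : Prop := ∀ η ∈ p.tree, 0 < muAt p η

/-- `p` is special: `μ^F_p(η) ≥ 2^(−2^(lh η + 1))` for every node `η`. -/
def Special (p : Cond T) : Prop :=
  ∀ η ∈ p.tree, ((2 : ℝ) ^ (2 ^ (η.length + 1)))⁻¹ ≤ muAt p η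

theorem initSeg_length (x : ℕ → ℕ) (n : ℕ) : (initSeg x n).length = n := by simp [initSeg]

theorem initSeg_prefix (x : ℕ → ℕ) {m n : ℕ} (h : m ≤ n) : initSeg x m <+: initSeg x n := by
  rw [List.prefix_iff_eq_take]
  simp [initSeg, ← List.map_take, List.take_range, h]

theorem eq_initSeg_of_prefix {x : ℕ → ℕ} {n : ℕ} {ν : List ℕ} (h : ν <+: initSeg x n) :
    ν = initSeg x ν.length := by
  have hl : ν.length ≤ n := by simpa [initSeg_length] using h.length_le
  exact (List.prefix_of_prefix_length_le h (initSeg_prefix x hl)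
    (by simp [initSeg_length])).eq_of_length (by simp [initSeg_length])

theorem exists_branch (P : List ℕ → Prop) (η : List ℕ) (hη : P η)
    (hstep : ∀ ρ, P ρ → ∃ a : ℕ, P (ρ ++ [a])) :
    ∃ x : ℕ → ℕ, initSeg x η.length = η ∧ ∀ n, η.length ≤ n → P (initSeg x n) := by
  choose! a ha using hstep
  let f : ℕ → List ℕ := fun n => Nat.rec η (fun _ ρ => ρ ++ [a ρ]) n
  have hf1 : ∀ n, f (n+1) = f n ++ [a (f n)] := fun n => rfl
  have hP : ∀ n, P (f n) := by
    intro n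
    induction n with
    | zero => exact hη
    | succ n ih => rw [hf1]; exact ha _ ih
  have hl : ∀ n, (f n).length = η.length + n := by
    intro n
    induction n with
    | zero => rfl
    | succ n ih => rw [hf1]; simp [ih]; omega
  have hpre : ∀ m n, m ≤ n → f m <+: f n := by
    intro m n h
    induction h with
    | refl => exact List.prefix_rfl
    | step h ih => exact ih.trans (by rw [Nat.succ_eq_add_one, hf1]; exact List.prefix_append _ _)
  let x : ℕ → ℕ := fun i => (f (i+1)).getD i 0
  have hx : ∀ n, initSeg x (η.length + n) = f n := by
    intro n
    apply List.ext_getElem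
    · simp [initSeg_length, hl]
    · intro i h1 h2
      have h3 : i < (f (i+1)).length := by have := hl (i+1); omega
      simp only [initSeg, List.getElem_map, List.getElem_range, x]
      rw [List.getD_eq_getElem _ _ h3]
      rcases le_total (i+1) n with h | h
      · exact (hpre _ _ h).getElem h3
      · exact ((hpre _ _ h).getElem h2).symm
  refine ⟨x, hx 0, fun n hn => ?_⟩
  obtain ⟨k, rfl⟩ := Nat.exists_eq_add_of_le hn
  rw [hx]; exact hP k

theorem pos_form {t : TCreature H} {ν : List ℕ} (h : ν ∈ t.pos) : ∃ a, ν = t.node ++ [a] := by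
  obtain ⟨⟨l, rfl⟩, h2, _⟩ := t.pos_ok ν h
  simp at h2
  obtain ⟨a, rfl⟩ := List.length_eq_one_iff.1 h2
  exact ⟨a, rfl⟩

theorem prefix_concat_cases {ν η : List ℕ} {a : ℕ} (h : ν <+: η ++ [a]) :
    ν = η ++ [a] ∨ ν <+: η := by
  exact List.prefix_concat_iff.1 h

/-- children stay in the tree -/
theorem child_mem (p : Cond T) {η ν : List ℕ} (hη : η ∈ p.tree) (h : ν ∈ (p.c η).pos) :
    ν ∈ p.tree ∧ η <+: ν ∧ ν.length = η.length + 1 := (p.succ_eq η hη ν).2 h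

theorem cond_induct (p : Cond T) (P : List ℕ → Prop) (h0 : P p.root)
    (hs : ∀ η ∈ p.tree, P η → ∀ ν ∈ (p.c η).pos, P ν) : ∀ ρ ∈ p.tree, P ρ := by
  intro ρ
  induction ρ using List.reverseRecOn with
  | nil =>
    intro h
    have : p.root = [] := by simpa using p.root_le _ h
    rwa [this] at h0
  | append_singleton η a ih =>
    intro h
    rcases prefix_concat_cases (p.root_le _ h) with h1 | h1
    · rwa [h1] at h0
    · have h2 : η ∈ p.tree := p.closed _ h _ h1 (List.prefix_append _ _)
      exact hs η h2 (ih h2) _ ((p.succ_eq η h2 _).1 ⟨h, List.prefix_append _ _, by simp⟩)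

theorem exists_branch_cond (p : Cond T) (P : List ℕ → Prop) (η : List ℕ) (hη : P η)
    (hmem : ∀ ρ, P ρ → ρ ∈ p.tree)
    (hstep : ∀ ρ, P ρ → ∃ ν ∈ (p.c ρ).pos, P ν) :
    ∃ x : ℕ → ℕ, IsBranchAt p η x ∧ ∀ n, η.length ≤ n → P (initSeg x n) := by
  obtain ⟨x, h1, h2⟩ := exists_branch P η hη (by
    intro ρ hρ
    obtain ⟨ν, hν, hP⟩ := hstep ρ hρ
    obtain ⟨a, rfl⟩ := pos_form hν
    rw [p.c_node ρ (hmem ρ hρ)] at hP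
    exact ⟨a, hP⟩)
  exact ⟨x, ⟨h1, fun n hn => hmem _ (h2 n hn)⟩, h2⟩

theorem exists_branch_through (p : Cond T) {η : List ℕ} (hη : η ∈ p.tree) :
    ∃ x : ℕ → ℕ, IsBranchAt p η x := by
  obtain ⟨x, hx, _⟩ := exists_branch_cond p (fun ρ => ρ ∈ p.tree) η hη (fun _ h => h) (by
    intro ρ hρ
    obtain ⟨ν, hν⟩ := (p.c ρ).pos_ne
    exact ⟨ν, hν, (child_mem p hρ hν).1⟩)
  exact ⟨x, hx⟩

theorem F_inf (hN : T.Nice) {t : TCreature H} (ht : t ∈ T.K) (g : ℕ → List ℕ → ℝ)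
    (hg : ∀ n, ∀ ν ∈ t.pos, g n ν ∈ Set.Icc (0:ℝ) 1)
    (ha : ∀ ν ∈ t.pos, Antitone (fun n => g n ν)) (v : ℝ) (hv : ∀ n, v ≤ T.F t (g n)) :
    v ≤ T.F t (fun ν => ⨅ n, g n ν) := by
  have hb : ∀ ν ∈ t.pos, BddBelow (Set.range fun n => g n ν) := by
    rintro ν hν
    exact ⟨0, by rintro _ ⟨n, rfl⟩; exact (hg n ν hν).1⟩
  apply le_of_forall_pos_le_add
  intro ε hε
  obtain ⟨r', h1, h2⟩ := hN.approx t ht (fun ν => ⨅ n, g n ν) (by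
    intro ν hν
    exact ⟨le_ciInf fun n => (hg n ν hν).1, (ciInf_le (hb ν hν) 0).trans (hg 0 ν hν).2⟩) ε hε
  have h3 : ∀ ν, ∃ n, ν ∈ t.pos → g n ν < r' ν := by
    intro ν
    by_cases hν : ν ∈ t.pos
    · obtain ⟨n, hn⟩ := exists_lt_of_ciInf_lt (h1 ν hν)
      exact ⟨n, fun _ => hn⟩
    · exact ⟨0, fun h => absurd h hν⟩
  choose n hn using h3
  have := h2 (g (t.pos.sup n)) (hg _) (fun ν hν =>
    ⟨ciInf_le (hb ν hν) _, (ha ν hν (Finset.le_sup hν)).trans_lt (hn ν hν)⟩)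
  exact (hv _).trans this.le

/-- A subsolution is below every front value. -/
theorem sub_le_front (hG : T.Good) (hN : T.Nice) (p : Cond T) (g : List ℕ → ℝ)
    (hg : ∀ η ∈ p.tree, g η ∈ Set.Icc (0:ℝ) 1)
    (hsub : ∀ η ∈ p.tree, g η ≤ T.F (p.c η) g) {η : List ℕ} (hη : η ∈ p.tree)
    {A : Set (List ℕ)} {m : List ℕ → ℝ} (hA : IsFrontAt p η A)
    (hm : IsMuAt p η A (fun _ => 1) m) : g η ≤ m η := by
  by_contra hcon
  let P : List ℕ → Prop := fun ρ => ρ ∈ p.tree ∧ η <+: ρ ∧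
    (∀ σ, η <+: σ → σ <+: ρ → σ ∉ A) ∧ ¬ (m ρ ∈ Set.Icc (0:ℝ) 1 ∧ g ρ ≤ m ρ)
  have hgood : ∀ ρ ∈ p.tree, ρ ∈ A → (m ρ ∈ Set.Icc (0:ℝ) 1 ∧ g ρ ≤ m ρ) := by
    intro ρ h h'
    rw [hm.1 ρ h']
    exact ⟨by simp, (hg ρ h).2⟩
  have hP0 : P η := by
    refine ⟨hη, List.prefix_rfl, ?_, fun h => hcon h.2⟩
    intro σ h1 h2 h3
    have : σ = η := List.IsPrefix.eq_of_length_le h2 h1.length_le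
    subst this
    exact hcon (hgood _ hη h3).2
  obtain ⟨x, hx, hxP⟩ := exists_branch_cond p P η hP0 (fun ρ h => h.1) (by
    rintro ρ ⟨h1, h2, h3, h4⟩
    by_contra hno
    push Not at hno
    have hch : ∀ ν ∈ (p.c ρ).pos, m ν ∈ Set.Icc (0:ℝ) 1 ∧ g ν ≤ m ν := by
      intro ν hν
      have hc := child_mem p h1 hν
      by_contra hbad
      refine hno ν hν ⟨hc.1, h2.trans hc.2.1, ?_, hbad⟩
      intro σ s1 s2 s3
      obtain ⟨a, rfl⟩ := pos_form hν
      rcases prefix_concat_cases s2 with h | h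
      · subst h; exact hbad (hgood _ hc.1 s3)
      · rw [p.c_node ρ h1] at h; exact h3 σ s1 h s3
    have hcone : InCone p η A ρ := by
      refine ⟨h1, h2, ?_⟩
      obtain ⟨x, hx⟩ := exists_branch_through p h1
      have hρ : ρ = initSeg x ρ.length := hx.1.symm
      obtain ⟨n, hn⟩ := hA.2 x ⟨by
        have : η <+: initSeg x ρ.length := hρ ▸ h2
        exact (eq_initSeg_of_prefix this).symm, by
        intro n hn
        rcases le_total ρ.length n with h | h
        · exact hx.2 n h
        · apply p.closed ρ h1
          · have h5 : η <+: initSeg x ρ.length := hρ ▸ h2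
            exact (p.root_le η hη).trans (by
              conv_lhs => rw [eq_initSeg_of_prefix h5]
              exact initSeg_prefix x hn)
          · rw [hρ]; exact initSeg_prefix x h⟩
      refine ⟨_, hn, ?_⟩
      rcases le_total ρ.length n with h | h
      · rw [hρ]; exact initSeg_prefix x h
      · exfalso
        refine h3 _ (hA.1 _ hn).2 ?_ hn
        rw [hρ]; exact initSeg_prefix x h
    have hnA : ρ ∉ A := h3 ρ h2 List.prefix_rfl
    apply h4
    rw [hm.2.1 ρ hcone hnA]
    refine ⟨hG.F_mem _ _ fun ν hν => (hch ν hν).1, (hsub ρ h1).trans ?_⟩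
    exact hN.mono _ (p.c_mem ρ h1) _ _ (fun ν hν => hg ν (child_mem p h1 hν).1)
      (fun ν hν => (hch ν hν).1) (fun ν hν => (hch ν hν).2))
  obtain ⟨n, hn⟩ := hA.2 x hx
  have h1 : η <+: initSeg x n := (hA.1 _ hn).2
  exact (hxP n (by simpa [initSeg_length] using h1.length_le)).2.2.1 _ h1 List.prefix_rfl hn

/-- Level iterates. -/
noncomputable def lev (p : Cond T) : ℕ → List ℕ → ℝ
  | 0, _ => 1
  | n+1, η => T.F (p.c η) (lev p n)

theorem lev_mem (hG : T.Good) (p : Cond T) (n : ℕ) (η : List ℕ) :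
    lev p n η ∈ Set.Icc (0:ℝ) 1 := by
  induction n generalizing η with
  | zero => simp [lev]
  | succ n ih => exact hG.F_mem _ _ fun ν _ => ih ν

theorem lev_anti (hG : T.Good) (hN : T.Nice) (p : Cond T) {η : List ℕ} (hη : η ∈ p.tree) :
    Antitone (fun n => lev p n η) := by
  apply antitone_nat_of_succ_le
  intro n
  induction n generalizing η with
  | zero => exact (lev_mem hG p 1 η).2
  | succ n ih =>
    exact hN.mono _ (p.c_mem η hη) _ _ (fun ν _ => lev_mem hG p _ ν)
      (fun ν _ => lev_mem hG p _ ν) (fun ν hν => ih (child_mem p hη hν).1)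

open Classical in
theorem lev_front (hG : T.Good) (p : Cond T) {η : List ℕ} (hη : η ∈ p.tree) (n : ℕ) :
    ∃ (A : Set (List ℕ)) (m : List ℕ → ℝ),
      IsFrontAt p η A ∧ IsMuAt p η A (fun _ => 1) m ∧ lev p n η = m η := by
  let A : Set (List ℕ) := {ρ | ρ ∈ p.tree ∧ η <+: ρ ∧ ρ.length = η.length + n}
  let m : List ℕ → ℝ := fun ρ => if ρ ∈ p.tree ∧ η <+: ρ ∧ ρ.length ≤ η.length + n then
    lev p (η.length + n - ρ.length) ρ else 0
  have hcone : ∀ ρ, InCone p η A ρ ↔ (ρ ∈ p.tree ∧ η <+: ρ ∧ ρ.length ≤ η.length + n) := by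
    intro ρ
    constructor
    · rintro ⟨h1, h2, ν, hν, h3⟩
      exact ⟨h1, h2, h3.length_le.trans hν.2.2.le⟩
    · rintro ⟨h1, h2, h3⟩
      obtain ⟨x, hx⟩ := exists_branch_through p h1
      have h4 : ρ <+: initSeg x (η.length + n) := by
        conv_lhs => rw [← hx.1]
        exact initSeg_prefix x h3
      exact ⟨h1, h2, _, ⟨hx.2 _ h3, h2.trans h4, initSeg_length _ _⟩, h4⟩
  refine ⟨A, m, ⟨fun ρ h => ⟨h.1, h.2.1⟩, ?_⟩, ⟨?_, ?_, ?_⟩, ?_⟩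
  · intro x hx
    refine ⟨η.length + n, hx.2 _ (by omega), ?_, initSeg_length _ _⟩
    conv_lhs => rw [← hx.1]
    exact initSeg_prefix x (by omega)
  · rintro ρ ⟨h1, h2, h3⟩
    simp only [m]
    rw [if_pos ⟨h1, h2, h3.le⟩, h3]; simp [lev]
  · intro ρ hc hA
    have h := (hcone ρ).1 hc
    have hlt : ρ.length < η.length + n := lt_of_le_of_ne h.2.2 fun e => hA ⟨h.1, h.2.1, e⟩
    obtain ⟨k, hk⟩ : ∃ k, η.length + n - ρ.length = k + 1 := ⟨η.length + n - ρ.length - 1, by omega⟩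
    have : m ρ = lev p (k+1) ρ := by simp only [m]; rw [if_pos h, hk]
    rw [this]
    apply hG.F_congr
    intro ν hν
    have hc' := child_mem p h.1 hν
    simp only [m]
    rw [if_pos ⟨hc'.1, h.2.1.trans hc'.2.1, by omega⟩]
    congr 1
    omega
  · intro ρ hc
    rw [hcone] at hc
    simp only [m]
    rw [if_neg hc]
  · simp only [m]
    rw [if_pos ⟨hη, List.prefix_rfl, by omega⟩]
    congr 1; omega

theorem le_muAt_of_sub (hG : T.Good) (hN : T.Nice) (p : Cond T) (g : List ℕ → ℝ)
    (hg : ∀ η ∈ p.tree, g η ∈ Set.Icc (0:ℝ) 1)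
    (hsub : ∀ η ∈ p.tree, g η ≤ T.F (p.c η) g) {η : List ℕ} (hη : η ∈ p.tree) :
    g η ≤ muAt p η := by
  apply le_csInf
  · obtain ⟨A, m, h1, h2, _⟩ := lev_front hG p hη 0
    exact ⟨_, A, m, h1, h2, rfl⟩
  · rintro _ ⟨A, m, h1, h2, rfl⟩
    exact sub_le_front hG hN p g hg hsub hη h1 h2

theorem levInf_mem (hG : T.Good) (p : Cond T) (η : List ℕ) :
    (⨅ n, lev p n η) ∈ Set.Icc (0:ℝ) 1 :=
  ⟨le_ciInf fun n => (lev_mem hG p n η).1,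
    (ciInf_le ⟨0, by rintro _ ⟨n, rfl⟩; exact (lev_mem hG p n η).1⟩ 0).trans
      (lev_mem hG p 0 η).2⟩

theorem levInf_sub (hG : T.Good) (hN : T.Nice) (p : Cond T) {η : List ℕ} (hη : η ∈ p.tree) :
    (⨅ n, lev p n η) ≤ T.F (p.c η) (fun ν => ⨅ n, lev p n ν) := by
  apply F_inf hN (p.c_mem η hη)
  · intro n ν _; exact lev_mem hG p n ν
  · intro ν hν; exact lev_anti hG hN p (child_mem p hη hν).1
  · intro n
    exact ciInf_le (f := fun n => lev p n η)
      ⟨0, by rintro _ ⟨n, rfl⟩; exact (lev_mem hG p n η).1⟩ (n+1)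

theorem muAt_eq (hG : T.Good) (hN : T.Nice) (p : Cond T) {η : List ℕ} (hη : η ∈ p.tree) :
    muAt p η = ⨅ n, lev p n η := by
  apply le_antisymm
  · apply le_ciInf
    intro n
    apply csInf_le
    · refine ⟨0, ?_⟩
      rintro _ ⟨A, m, h1, h2, rfl⟩
      exact sub_le_front hG hN p (fun _ => 0) (by simp)
        (fun η _ => (hG.F_mem _ _ (by simp)).1) hη h1 h2
    · exact lev_front hG p hη n
  · exact le_muAt_of_sub hG hN p (fun η => ⨅ n, lev p n η) (fun η _ => levInf_mem hG p η)
      (fun η h => levInf_sub hG hN p h) hη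

theorem muAt_mem (hG : T.Good) (hN : T.Nice) (p : Cond T) {η : List ℕ} (hη : η ∈ p.tree) :
    muAt p η ∈ Set.Icc (0:ℝ) 1 := by
  rw [muAt_eq hG hN p hη]; exact levInf_mem hG p η

theorem muAt_sub (hG : T.Good) (hN : T.Nice) (p : Cond T) {η : List ℕ} (hη : η ∈ p.tree) :
    muAt p η ≤ T.F (p.c η) (muAt p) := by
  rw [muAt_eq hG hN p hη, hG.F_congr _ (muAt p) (fun ν => ⨅ n, lev p n ν)]
  · exact levInf_sub hG hN p hη
  · intro ν hν
    exact muAt_eq hG hN p (child_mem p hη hν).1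

/-- The tree generated from a root by a choice of creatures. -/
inductive Gen (c : List ℕ → TCreature H) (ρ : List ℕ) : List ℕ → Prop
  | base : Gen c ρ ρ
  | step {η ν : List ℕ} : Gen c ρ η → ν ∈ (c η).pos → Gen c ρ ν

theorem exists_gen (T : MTriple H) (c : List ℕ → TCreature H) (ρ : List ℕ) (G : Set (List ℕ))
    (h0 : ρ ∈ G) (hK : ∀ η ∈ G, c η ∈ T.K) (hn : ∀ η ∈ G, (c η).node = η)
    (hs : ∀ η ∈ G, ∀ ν ∈ (c η).pos, ν ∈ G) :
    ∃ q : Cond T, q.root = ρ ∧ q.c = c ∧ q.tree ⊆ G := by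
  have hsub : ∀ η, Gen c ρ η → η ∈ G := by
    intro η h
    induction h with
    | base => exact h0
    | step _ hν ih => exact hs _ ih _ hν
  have hle : ∀ η, Gen c ρ η → ρ <+: η := by
    intro η h
    induction h with
    | base => exact List.prefix_rfl
    | @step η ν h hν ih =>
      have := ((c η).pos_ok _ hν).1
      rw [hn _ (hsub _ h)] at this
      exact ih.trans this
  refine ⟨{ tree := {η | Gen c ρ η}, root := ρ, root_mem := Gen.base, root_le := hle,
            closed := ?_, c := c, c_mem := fun η h => hK η (hsub η h),
            c_node := fun η h => hn η (hsub η h), succ_eq := ?_ }, rfl, rfl, hsub⟩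
  · intro η h0'
    have h : Gen c ρ η := h0'
    clear h0'
    induction h with
    | base =>
      intro ν h1 h2
      have : ν = ρ := List.IsPrefix.eq_of_length_le h2 h1.length_le
      subst this; exact Gen.base
    | @step η ν h hν ih =>
      intro σ h1 h2
      obtain ⟨a, rfl⟩ := pos_form hν
      rcases prefix_concat_cases h2 with h3 | h3
      · subst h3; exact Gen.step h hν
      · rw [hn _ (hsub _ h)] at h3; exact ih σ h1 h3
  · intro η h ν
    have hnode := hn η (hsub η h)
    constructor
    · rintro ⟨h1, h2, h3⟩
      have h1 : Gen c ρ ν := h1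
      cases h1 with
      | base => have := (hle η h).length_le; omega
      | @step η' _ h' hν =>
        have h4 := (c η').pos_ok ν hν
        rw [hn _ (hsub _ h')] at h4
        have : η' = η := (List.prefix_of_prefix_length_le h4.1 h2 (by omega)).eq_of_length
          (by omega)
        exact this ▸ hν
    · intro hν
      have h4 := (c η).pos_ok ν hν
      rw [hnode] at h4
      exact ⟨Gen.step h hν, h4.1, h4.2.1⟩

/-- Candidate values at a node. -/
def cands (p : Cond T) (g : List ℕ → ℝ) (θ : ℝ) (η : List ℕ) : Set ℝ :=
  {v | ∃ s ∈ T.Sig (p.c η), (p.c η).nor - 2 ≤ s.nor ∧ (∀ ν ∈ s.pos, 0 < g ν) ∧ θ ≤ v ∧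
    v = T.F s g}

open Classical in
/-- Iterated optimal values. -/
noncomputable def itr (p : Cond T) (B : Set (List ℕ)) (θ : List ℕ → ℝ) (u w : ℝ) :
    ℕ → List ℕ → ℝ
  | 0, η => if η ∈ B then u else w
  | n+1, η => if η ∈ B then u else sSup (cands p (itr p B θ u w n) (θ η) η)

theorem cands_finite (hG : T.Good) (p : Cond T) (g : List ℕ → ℝ) (θ : ℝ) {η : List ℕ}
    (hη : η ∈ p.tree) : (cands p g θ η).Finite := by
  apply ((hG.finitary η).image (fun s => T.F s g)).subset
  rintro v ⟨s, hs, _, _, _, rfl⟩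
  exact ⟨s, ⟨hG.sig_mem _ (p.c_mem η hη) hs, by
    rw [hG.sig_node _ _ hs, p.c_node η hη]⟩, rfl⟩

theorem itr_mem (hG : T.Good) (p : Cond T) (B : Set (List ℕ)) (θ : List ℕ → ℝ) {u w : ℝ}
    (hu : u ∈ Set.Icc (0:ℝ) 1) (hw : w ∈ Set.Icc (0:ℝ) 1) (n : ℕ) (η : List ℕ) :
    itr p B θ u w n η ∈ Set.Icc (0:ℝ) 1 := by
  induction n generalizing η with
  | zero => unfold itr; split_ifs <;> assumption
  | succ n ih =>
    unfold itr
    split_ifs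
    · exact hu
    · constructor
      · apply Real.sSup_nonneg
        rintro v ⟨s, _, _, _, _, rfl⟩
        exact (hG.F_mem s _ fun ν _ => ih ν).1
      · apply Real.sSup_le _ zero_le_one
        rintro v ⟨s, _, _, _, _, rfl⟩
        exact (hG.F_mem s _ fun ν _ => ih ν).2

theorem itr_of_mem (p : Cond T) {B : Set (List ℕ)} (θ : List ℕ → ℝ) (u w : ℝ) (n : ℕ)
    {η : List ℕ} (h : η ∈ B) : itr p B θ u w n η = u := by
  cases n <;> simp [itr, h]

theorem itr_ge (hG : T.Good) (p : Cond T) {B : Set (List ℕ)} (θ : List ℕ → ℝ) (u w : ℝ) (n : ℕ)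
    {η : List ℕ} (h : η ∉ B) (hη : η ∈ p.tree) {s : TCreature H} (hs : s ∈ T.Sig (p.c η))
    (hn : (p.c η).nor - 2 ≤ s.nor) (hpos : ∀ ν ∈ s.pos, 0 < itr p B θ u w n ν)
    (hθ : θ η ≤ T.F s (itr p B θ u w n)) :
    T.F s (itr p B θ u w n) ≤ itr p B θ u w (n+1) η := by
  rw [itr, if_neg h]
  exact le_csSup (cands_finite hG p _ _ hη).bddAbove ⟨s, hs, hn, hpos, hθ, rfl⟩

theorem itr_pos_succ (hG : T.Good) (p : Cond T) {B : Set (List ℕ)} (θ : List ℕ → ℝ) (u w : ℝ)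
    (n : ℕ) {η : List ℕ} (h : η ∉ B) (hη : η ∈ p.tree)
    (hpos : 0 < itr p B θ u w (n+1) η) :
    ∃ s ∈ T.Sig (p.c η), (p.c η).nor - 2 ≤ s.nor ∧
      (∀ ν ∈ s.pos, 0 < itr p B θ u w n ν) ∧ θ η ≤ itr p B θ u w (n+1) η ∧
      itr p B θ u w (n+1) η = T.F s (itr p B θ u w n) := by
  rw [itr, if_neg h] at hpos ⊢
  have hne : (cands p (itr p B θ u w n) (θ η) η).Nonempty := by
    by_contra h0
    rw [Set.not_nonempty_iff_eq_empty] at h0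
    simp [h0] at hpos
  exact hne.csSup_mem (cands_finite hG p _ _ hη)

/-- The small numbers. -/
noncomputable def sx (k : ℕ) : ℝ := ((2 : ℝ) ^ (2 ^ k))⁻¹

theorem sx_pos (k : ℕ) : 0 < sx k := by unfold sx; positivity

theorem sx_succ (k : ℕ) : sx (k+1) = sx k ^ 2 := by
  unfold sx; rw [pow_succ 2 k, pow_mul, inv_pow]

theorem sx_bound {k : ℕ} (hk : 4 < k) : 16 * sx k ≤ ((2:ℝ)^k)⁻¹ := by
  unfold sx
  have h : k + 4 ≤ 2 ^ k := by
    obtain ⟨m, rfl⟩ := Nat.exists_eq_add_of_le (show 5 ≤ k from hk)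
    induction m with
    | zero => norm_num
    | succ m ih => have := ih (by omega); rw [← add_assoc, pow_succ]; omega
  have h2 : (2:ℝ)^(k+4) ≤ 2 ^ (2^k) := pow_le_pow_right₀ (by norm_num) h
  rw [← div_eq_mul_inv, div_le_iff₀ (by positivity), inv_mul_eq_div, le_div_iff₀ (by positivity)]
  calc _ = (2:ℝ)^(k+4) := by rw [pow_add]; norm_num; ring
    _ ≤ _ := h2

theorem inv_two_pow_small {k : ℕ} (hk : 4 < k) : ((2:ℝ)^k)⁻¹ ≤ 1/32 := by
  have : (2:ℝ)^5 ≤ 2^k := pow_le_pow_right₀ (by norm_num) hk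
  rw [inv_le_comm₀ (by positivity) (by norm_num)]
  linarith

theorem sx_small {k : ℕ} (hk : 4 < k) : sx k ≤ 1/512 := by
  have := sx_bound hk
  have := inv_two_pow_small hk
  linarith

theorem F_zero (hN : T.Nice) {t : TCreature H} (ht : t ∈ T.K) : T.F t (fun _ => 0) = 0 := by
  have := hN.scale t ht 0 (by simp) (fun _ => 0) (by simp)
  simpa using this

theorem F_le_const (hG : T.Good) (hN : T.Nice) {t : TCreature H} (ht : t ∈ T.K) {b : ℝ}
    (hb : b ∈ Set.Icc (0:ℝ) 1) (r : List ℕ → ℝ) (hr : ∀ ν ∈ t.pos, r ν ∈ Set.Icc (0:ℝ) b) :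
    T.F t r ≤ b := by
  have h1 := hN.scale t ht b hb (fun _ => 1) (by simp)
  have h2 := hN.mono t ht r (fun _ => b * 1) (fun ν hν => ⟨(hr ν hν).1, (hr ν hν).2.trans hb.2⟩)
    (fun _ _ => by simpa using hb) (fun ν hν => by simpa using (hr ν hν).2)
  have h3 := (hG.F_mem t (fun _ => 1) (by simp)).2
  calc _ ≤ _ := h2
    _ = b * T.F t (fun _ => 1) := h1
    _ ≤ b := mul_le_of_le_one_right hb.1 h3

open Classical in
/-- pruning of the small nodes -/
theorem prune (hG : T.Good) (hN : T.Nice) (p : Cond T)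
    (hpnor : ∀ η ∈ p.tree, 2 < (p.c η).nor) {η : List ℕ} (hη : η ∈ p.tree)
    (hk : 4 < η.length) (hM : 4 * sx η.length ≤ muAt p η) :
    ∃ s ∈ T.Sig (p.c η), (p.c η).nor - 1 ≤ s.nor ∧
      (∀ ν ∈ s.pos, 4 * sx ν.length ≤ muAt p ν) ∧
      (1 - 2 * sx η.length) * muAt p η ≤ T.F s (muAt p) := by
  set x := sx η.length with hx
  have hx0 : 0 < x := sx_pos _
  have hx1 : x ≤ 1/512 := sx_small hk
  have hsub := muAt_sub hG hN p hη
  have htK := p.c_mem η hη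
  have hnode := p.c_node η hη
  let r0 : List ℕ → ℝ := fun ν => if 4 * x^2 ≤ muAt p ν then muAt p ν else 0
  let r1 : List ℕ → ℝ := fun ν => if 4 * x^2 ≤ muAt p ν then 0 else muAt p ν
  have hmem : ∀ ν ∈ (p.c η).pos, muAt p ν ∈ Set.Icc (0:ℝ) 1 := fun ν hν =>
    muAt_mem hG hN p (child_mem p hη hν).1
  obtain ⟨c0, c1, s0, s1, hs0, hs1, hc, h0, h1⟩ := hN.split (p.c η) htK
    (by linarith [hpnor η hη]) (muAt p) r0 r1 (by
      intro ν hν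
      have := hmem ν hν
      refine ⟨this, ?_, ?_⟩
      · simp only [r0]; split_ifs
        · exact this
        · simp
      · simp only [r1]; split_ifs
        · simp
        · exact this) (by
      intro ν hν
      simp only [r0, r1]; split_ifs <;> simp) (by
      rw [hnode]; change x ≤ _; linarith)
  rw [hnode] at hc
  change c0 + c1 = (1 - x) * _ at hc
  have hc1 : c1 ≤ 4 * x^2 := by
    by_cases h : 0 < c1
    · refine (h1 h).2.2.trans (F_le_const hG hN (hG.sig_mem _ htK hs1) ⟨by positivity, by nlinarith⟩
        _ ?_)
      intro ν hν
      have := hmem ν (hG.sig_pos _ _ hs1 hν)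
      simp only [r1]; split_ifs with h'
      · exact ⟨le_rfl, by positivity⟩
      · exact ⟨this.1, (not_le.1 h').le⟩
    · nlinarith
  have hc0 : (1 - 2 * x) * muAt p η ≤ c0 := by nlinarith
  have hc0' : 0 < c0 := by nlinarith
  obtain ⟨g1, g2, g3⟩ := h0 hc0'
  have hbig : ∀ ν ∈ s0.pos, 4 * x^2 ≤ muAt p ν := by
    intro ν hν
    have := g2 ν hν
    simp only [r0] at this
    by_contra h
    simp [h] at this
  refine ⟨s0, hs0, g1, ?_, ?_⟩
  · intro ν hν
    have hl := (child_mem p hη (hG.sig_pos _ _ hs0 hν)).2.2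
    rw [hl, sx_succ]; exact hbig ν hν
  · refine hc0.trans (g3.trans_eq (hG.F_congr _ _ _ ?_))
    intro ν hν
    simp only [r0]; rw [if_pos (hbig ν hν)]

theorem main_step (hG : T.Good) (hN : T.Nice) (p : Cond T)
    (hpnor : ∀ η ∈ p.tree, 2 < (p.c η).nor) (hk0 : 4 < p.root.length) (B : Set (List ℕ))
    (e : ℝ) (he : 3/4 ≤ e) (he1 : e ≤ 1) (n : ℕ) :
    ∀ η ∈ p.tree, 4 * sx η.length ≤ muAt p η →
      e * (1 - 8 * sx η.length) * muAt p η ≤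
        itr p B (fun η => sx η.length ^ 2) 0 1 n η + itr p B (fun _ => 0) e 0 n η := by
  have hAm : ∀ n η, itr p B (fun η => sx η.length ^ 2) 0 1 n η ∈ Set.Icc (0:ℝ) 1 :=
    itr_mem hG p B _ (by simp) (by simp)
  have hBm : ∀ n η, itr p B (fun _ => 0) e 0 n η ∈ Set.Icc (0:ℝ) 1 :=
    itr_mem hG p B _ ⟨by linarith, he1⟩ (by simp)
  have easy : ∀ η ∈ p.tree, 4 * sx η.length ≤ muAt p η →
      e * (1 - 8 * sx η.length) * muAt p η ≤ e := by
    intro η hη h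
    have hM := muAt_mem hG hN p hη
    have hx0 := sx_pos η.length
    have h1 : (1 - 8 * sx η.length) * muAt p η ≤ 1 := by nlinarith [hM.1, hM.2]
    rw [mul_assoc]
    exact mul_le_of_le_one_right (by linarith) h1
  induction n with
  | zero =>
    intro η hη h
    have := easy η hη h
    by_cases hB : η ∈ B
    · rw [itr_of_mem p _ _ _ _ hB, itr_of_mem p _ _ _ _ hB]; linarith
    · simp only [itr, hB, if_false]; linarith
  | succ n ih =>
    intro η hη h
    by_cases hB : η ∈ B
    · have := easy η hη h
      rw [itr_of_mem p _ _ _ _ hB, itr_of_mem p _ _ _ _ hB]; linarith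
    have hk : 4 < η.length := hk0.trans_le (p.root_le η hη).length_le
    obtain ⟨s, hs, hsn, hsbig, hsF⟩ := prune hG hN p hpnor hη hk h
    have htK := p.c_mem η hη
    have hsK := hG.sig_mem _ htK hs
    have hsnode : s.node = η := by rw [hG.sig_node _ _ hs, p.c_node η hη]
    have hchild : ∀ ν ∈ s.pos, ν ∈ p.tree ∧ ν.length = η.length + 1 := fun ν hν =>
      let h := child_mem p hη (hG.sig_pos _ _ hs hν)
      ⟨h.1, h.2.2⟩
    set x := sx η.length with hx
    have hx0 : 0 < x := sx_pos _
    have hx1 : x ≤ 1/512 := sx_small hk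
    set M := muAt p η with hMdef
    have hMm := muAt_mem hG hN p hη
    set C := e * (1 - 8 * x^2) with hC
    have hx2 : 8 * x^2 ≤ 1/2 := by nlinarith
    have hC0 : 3/8 ≤ C := by nlinarith
    have hC1 : C ≤ 1 := by nlinarith
    have hsmem : ∀ ν ∈ s.pos, muAt p ν ∈ Set.Icc (0:ℝ) 1 := fun ν hν =>
      muAt_mem hG hN p (hchild ν hν).1
    have hscale := hN.scale s hsK C ⟨by linarith, hC1⟩ (muAt p) hsmem
    have hF1 : C * ((1 - 2 * x) * M) ≤ T.F s (fun ν => C * muAt p ν) := by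
      rw [hscale]; exact mul_le_mul_of_nonneg_left hsF (by linarith)
    have hCM : C * (4 * x) ≤ C * M := mul_le_mul_of_nonneg_left h (by linarith)
    have hCM2 : 3/8 * (4 * x) ≤ C * (4 * x) := mul_le_mul_of_nonneg_right hC0 (by linarith)
    have hCM3 : 3/2 * x ≤ C * M := by linarith
    have hCM4 : (1 - 2*x) * (3/2 * x) ≤ (1 - 2*x) * (C * M) :=
      mul_le_mul_of_nonneg_left hCM3 (by linarith)
    have hxF : x ≤ T.F s (fun ν => C * muAt p ν) := by nlinarith
    obtain ⟨d0, d1, s0, s1, hs0, hs1, hd, h0, h1⟩ := hN.split s hsK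
      (by linarith [hpnor η hη]) (fun ν => C * muAt p ν)
      (itr p B (fun η => sx η.length ^ 2) 0 1 n) (itr p B (fun _ => 0) e 0 n) (by
        intro ν hν
        have := hsmem ν hν
        exact ⟨⟨mul_nonneg (by linarith) this.1, mul_le_one₀ hC1 this.1 this.2⟩,
          hAm _ _, hBm _ _⟩) (by
        intro ν hν
        have := ih ν (hchild ν hν).1 (hsbig ν hν)
        rw [(hchild ν hν).2, sx_succ] at this
        exact this) (by rw [hsnode]; exact hxF)
    rw [hsnode] at hd
    change d0 + d1 = (1 - x) * _ at hd
    have hB1 : d1 ≤ itr p B (fun _ => 0) e 0 (n+1) η := by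
      by_cases hd1 : 0 < d1
      · obtain ⟨g1, g2, g3⟩ := h1 hd1
        exact g3.trans (itr_ge hG p _ _ _ n hB hη (hG.sig_trans _ _ hs hs1) (by linarith) g2
          (by linarith))
      · exact (not_lt.1 hd1).trans (hBm _ _).1
    have hA1 : d0 - x^2 ≤ itr p B (fun η => sx η.length ^ 2) 0 1 (n+1) η := by
      by_cases hd0 : x^2 ≤ d0
      · have hpos : 0 < x^2 := by positivity
        obtain ⟨g1, g2, g3⟩ := h0 (by linarith)
        have := (itr_ge hG p (fun η => sx η.length ^ 2) 0 1 n hB hη (hG.sig_trans _ _ hs hs0)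
          (by linarith) g2 (hd0.trans g3))
        linarith
      · exact le_trans (by linarith) (hAm _ _).1
    have hCMx : x * (3/2 * x) ≤ x * (C * M) := mul_le_mul_of_nonneg_left hCM3 hx0.le
    have hFx : (1 - x) * (C * ((1 - 2 * x) * M)) ≤ (1-x) * T.F s (fun ν => C * muAt p ν) :=
      mul_le_mul_of_nonneg_left hF1 (by linarith)
    have key : (1 - 4*x) * (C * M) ≤ d0 + d1 - x^2 := by
      have : 0 ≤ x^2 * (C * M) := mul_nonneg (sq_nonneg x) (by linarith)
      nlinarith
    have heM : 0 ≤ e * M := mul_nonneg (by linarith) hMm.1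
    have fin : e * (1 - 8 * x) * M ≤ (1 - 4*x) * (C * M) := by
      have h5 : (1 - 8*x) ≤ (1 - 4*x) * (1 - 8*x^2) := by nlinarith [pow_pos hx0 3]
      have := mul_le_mul_of_nonneg_right h5 heM
      rw [hC]; nlinarith
    linarith

theorem itrA_anti (hG : T.Good) (hN : T.Nice) (p : Cond T) (B : Set (List ℕ))
    (θ : List ℕ → ℝ) {η : List ℕ} (hη : η ∈ p.tree) :
    Antitone (fun n => itr p B θ 0 1 n η) := by
  have hAm : ∀ n η, itr p B θ 0 1 n η ∈ Set.Icc (0:ℝ) 1 :=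
    itr_mem hG p B _ (by simp) (by simp)
  apply antitone_nat_of_succ_le
  intro n
  induction n generalizing η with
  | zero =>
    by_cases hB : η ∈ B
    · rw [itr_of_mem p _ _ _ _ hB, itr_of_mem p _ _ _ _ hB]
    · refine (hAm 1 η).2.trans ?_
      simp [itr, hB]
  | succ n ih =>
    by_cases hB : η ∈ B
    · rw [itr_of_mem p _ _ _ _ hB, itr_of_mem p _ _ _ _ hB]
    by_cases hpos : 0 < itr p B θ 0 1 (n+1+1) η
    · obtain ⟨s, hs, h1, h2, h3, h4⟩ := itr_pos_succ hG p θ 0 1 (n+1) hB hη hpos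
      have hch : ∀ ν ∈ s.pos, itr p B θ 0 1 (n+1) ν ≤ itr p B θ 0 1 n ν := fun ν hν =>
        ih (child_mem p hη (hG.sig_pos _ _ hs hν)).1
      have hF := hN.mono s (hG.sig_mem _ (p.c_mem η hη) hs) _ _ (fun ν _ => hAm (n+1) ν)
        (fun ν _ => hAm n ν) hch
      rw [h4] at h3 ⊢
      exact hF.trans (itr_ge hG p θ 0 1 n hB hη hs h1
        (fun ν hν => (h2 ν hν).trans_le (hch ν hν)) (h3.trans hF))
    · exact (not_lt.1 hpos).trans (hAm _ _).1

theorem itrA_limit (hG : T.Good) (hN : T.Nice) (p : Cond T) (B : Set (List ℕ))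
    (θ : List ℕ → ℝ) {η : List ℕ} (hη : η ∈ p.tree)
    (hpos : ∀ n, 0 < itr p B θ 0 1 n η) :
    ∃ s ∈ T.Sig (p.c η), (p.c η).nor - 2 ≤ s.nor ∧
      (∀ ν ∈ s.pos, ∀ n, 0 < itr p B θ 0 1 n ν) ∧
      (⨅ n, itr p B θ 0 1 n η) ≤ T.F s (fun ν => ⨅ n, itr p B θ 0 1 n ν) := by
  have hAm : ∀ n η, itr p B θ 0 1 n η ∈ Set.Icc (0:ℝ) 1 :=
    itr_mem hG p B _ (by simp) (by simp)
  have hB : η ∉ B := fun h => by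
    have := hpos 0
    rw [itr_of_mem p _ _ _ _ h] at this
    exact lt_irrefl _ this
  choose s hs h1 h2 h3 h4 using fun n => itr_pos_succ hG p θ 0 1 n hB hη (hpos (n+1))
  have hsK : ∀ n, s n ∈ {t : TCreature H | t ∈ T.K ∧ t.node = η} := fun n =>
    ⟨hG.sig_mem _ (p.c_mem η hη) (hs n), by rw [hG.sig_node _ _ (hs n), p.c_node η hη]⟩
  have : ∃ t, ∀ N, ∃ n ≥ N, s n = t := by
    by_contra hcon
    push Not at hcon
    choose N hNN using hcon
    obtain ⟨b, hb⟩ := ((hG.finitary η).image N).bddAbove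
    exact hNN (s b) b (hb ⟨_, hsK b, rfl⟩) rfl
  obtain ⟨t, ht⟩ := this
  obtain ⟨n0, -, hn0⟩ := ht 0
  have hchild : ∀ ν ∈ t.pos, ν ∈ p.tree := fun ν hν =>
    (child_mem p hη (hG.sig_pos _ _ (hs n0) (hn0 ▸ hν))).1
  refine ⟨t, hn0 ▸ hs n0, hn0 ▸ h1 n0, ?_, ?_⟩
  · intro ν hν n
    obtain ⟨m, hm, rfl⟩ := ht n
    exact (h2 m ν hν).trans_le (itrA_anti hG hN p B θ (hchild ν hν) hm)
  · have htK : t ∈ T.K := hn0 ▸ (hsK n0).1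
    apply F_inf hN htK
    · intro n ν _; exact hAm n ν
    · intro ν hν; exact itrA_anti hG hN p B θ (hchild ν hν)
    · intro n
      obtain ⟨m, hm, rfl⟩ := ht n
      refine (ciInf_le ⟨0, by rintro _ ⟨n, rfl⟩; exact (hAm n η).1⟩ (m+1)).trans ?_
      rw [h4 m]
      exact hN.mono _ htK _ _ (fun ν _ => hAm m ν) (fun ν _ => hAm n ν)
        (fun ν hν => itrA_anti hG hN p B θ (hchild ν hν) hm)

theorem itrA_gap (hG : T.Good) (p : Cond T) (B : Set (List ℕ))
    (θ : List ℕ → ℝ) (hθ : ∀ η ∈ p.tree, θ η ≤ 1) {η : List ℕ} (hη : η ∈ p.tree) {n : ℕ}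
    (hpos : 0 < itr p B θ 0 1 n η) : θ η ≤ itr p B θ 0 1 n η := by
  have hB : η ∉ B := fun h => by
    rw [itr_of_mem p _ _ _ _ h] at hpos
    exact lt_irrefl _ hpos
  cases n with
  | zero => simpa [itr, hB] using hθ η hη
  | succ n => exact (itr_pos_succ hG p θ 0 1 n hB hη hpos).choose_spec.2.2.2.1

/-- Case (i). -/
theorem avoid_case (hG : T.Good) (hN : T.Nice) (p : Cond T) (hp4 : Qtree4 p)
    (B : Set (List ℕ)) (θ : List ℕ → ℝ) (hθ0 : ∀ η ∈ p.tree, 0 < θ η)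
    (hθ : ∀ η ∈ p.tree, θ η ≤ 1) (hroot : ∀ n, 0 < itr p B θ 0 1 n p.root) :
    ∃ q' : Cond T, Qtree4 q' ∧ 0 < muF q' ∧ Normal q' ∧ CondLe p q' ∧
      q'.root = p.root ∧ ∀ ν ∈ B, ν ∉ q'.tree := by
  have hAm : ∀ n η, itr p B θ 0 1 n η ∈ Set.Icc (0:ℝ) 1 :=
    itr_mem hG p B _ (by simp) (by simp)
  let G : Set (List ℕ) := {η | η ∈ p.tree ∧ ∀ n, 0 < itr p B θ 0 1 n η}
  have hlim : ∀ η, ∃ s, η ∈ G → s ∈ T.Sig (p.c η) ∧ (p.c η).nor - 2 ≤ s.nor ∧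
      (∀ ν ∈ s.pos, ∀ n, 0 < itr p B θ 0 1 n ν) ∧
      (⨅ n, itr p B θ 0 1 n η) ≤ T.F s (fun ν => ⨅ n, itr p B θ 0 1 n ν) := by
    intro η
    by_cases h : η ∈ G
    · obtain ⟨s, h1, h2⟩ := itrA_limit hG hN p B θ h.1 h.2
      exact ⟨s, fun _ => ⟨h1, h2⟩⟩
    · exact ⟨p.c η, fun h' => absurd h' h⟩
  choose c hc using hlim
  obtain ⟨q, hqr, hqc, hqG⟩ := exists_gen T c p.root G ⟨p.root_mem, hroot⟩
    (fun η h => hG.sig_mem _ (p.c_mem η h.1) (hc η h).1)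
    (fun η h => by rw [hG.sig_node _ _ (hc η h).1, p.c_node η h.1])
    (fun η h ν hν => ⟨(child_mem p h.1 (hG.sig_pos _ _ (hc η h).1 hν)).1, (hc η h).2.2.1 ν hν⟩)
  have hnorm : Normal q := by
    intro η hη
    have h := hqG hη
    have h1 := le_muAt_of_sub hG hN q (fun ν => ⨅ n, itr p B θ 0 1 n ν)
      (fun ν _ => ⟨le_ciInf fun n => (hAm n ν).1,
        (ciInf_le ⟨0, by rintro _ ⟨n, rfl⟩; exact (hAm n ν).1⟩ 0).trans (hAm 0 ν).2⟩)
      (fun ν hν => by rw [hqc]; exact (hc ν (hqG hν)).2.2.2) hη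
    have h2 : θ η ≤ ⨅ n, itr p B θ 0 1 n η := le_ciInf fun n => itrA_gap hG p B θ hθ h.1 (h.2 n)
    exact (hθ0 η h.1).trans_le (h2.trans h1)
  refine ⟨q, ?_, hnorm _ q.root_mem, hnorm, ⟨fun η h => (hqG h).1, ?_⟩, hqr, ?_⟩
  · intro n
    obtain ⟨A, hA1, hA2⟩ := hp4 (n+2)
    refine ⟨A ∩ q.tree, ⟨fun ρ h => ⟨h.2, q.root_le _ h.2⟩, ?_⟩, ?_⟩
    · intro x hx
      obtain ⟨m, hm⟩ := hA1.2 x ⟨hqr ▸ hx.1, fun n hn => (hqG (hx.2 n (hqr ▸ hn))).1⟩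
      refine ⟨m, hm, hx.2 m ?_⟩
      have := (hA1.1 _ hm).2.length_le
      rw [initSeg_length] at this
      rwa [hqr]
    · intro ν hν ρ hρ hνρ
      have h1 := hA2 ν hν.1 ρ (hqG hρ).1 hνρ
      have h2 := (hc ρ (hqG hρ)).2.1
      rw [hqc]
      push_cast at h1
      linarith
  · intro η h
    rw [hqc]; exact (hc η (hqG h)).1
  · intro ν hν h
    have := (hqG h).2 0
    rw [itr_of_mem p _ _ _ _ hν] at this
    exact lt_irrefl _ this

open Classical in
/-- Case (ii). -/
theorem capture_case (hG : T.Good) (hN : T.Nice) (p : Cond T)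
    (B : Set (List ℕ)) (e : ℝ) (he0 : 0 < e) (he1 : e ≤ 1) (hB : B ⊆ p.tree)
    (hBanti : ∀ ν ∈ B, ∀ ν' ∈ B, ν <+: ν' → ν = ν')
    (q : List ℕ → Cond T)
    (hq : ∀ ν ∈ B,
      Qtree4 (q ν) ∧ 0 < muF (q ν) ∧ Normal (q ν) ∧ (q ν).root = ν ∧
      (q ν).tree ⊆ {ρ ∈ p.tree | ν <+: ρ} ∧
      (∀ η ∈ (q ν).tree, (q ν).c η ∈ T.Sig (p.c η)) ∧
      e ≤ muF (q ν)) (N : ℕ) (hroot : 0 < itr p B (fun _ => 0) e 0 N p.root) :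
    ∃ q' : Cond T, Qtree4 q' ∧ 0 < muF q' ∧ Normal q' ∧ CondLe p q' ∧
      q'.root = p.root ∧
      itr p B (fun _ => 0) e 0 N p.root ≤ muF q' ∧
      IsFrontAt q' q'.root (q'.tree ∩ B) ∧
      (∀ ν ∈ q'.tree ∩ B,
        (q ν).tree = {ρ ∈ q'.tree | ν <+: ρ} ∧
        ∀ ρ ∈ (q ν).tree, (q ν).c ρ = q'.c ρ) ∧
      (∀ η ∈ q'.tree, (∃ ν ∈ B, η <+: ν ∧ η ≠ ν) →
        (p.c η).nor - 2 ≤ (q'.c η).nor) := by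
  set b := itr p B (fun _ => 0) e 0 with hb
  have hBm : ∀ n η, b n η ∈ Set.Icc (0:ℝ) 1 :=
    itr_mem hG p B _ ⟨he0.le, he1⟩ (by simp)
  have huniq : ∀ {ν ν' η : List ℕ}, ν ∈ B → ν' ∈ B → ν <+: η → ν' <+: η → ν = ν' := by
    intro ν ν' η h h' h1 h2
    rcases List.prefix_or_prefix_of_prefix h1 h2 with h3 | h3
    · exact hBanti _ h _ h' h3
    · exact (hBanti _ h' _ h h3).symm
  let k := p.root.length
  let rem : List ℕ → ℕ := fun η => N - (η.length - k)
  -- inner nodes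
  let I : Set (List ℕ) := {η | η ∈ p.tree ∧ (∀ ν ∈ B, ¬ ν <+: η) ∧ 0 < b (rem η) η}
  let O : Set (List ℕ) := {η | ∃ ν ∈ B, η ∈ (q ν).tree}
  have hstep : ∀ η, ∃ s, η ∈ I → s ∈ T.Sig (p.c η) ∧ (p.c η).nor - 2 ≤ s.nor ∧
      (∀ ν ∈ s.pos, 0 < b (rem ν) ν) ∧ b (rem η) η ≤ T.F s (fun ν => b (rem ν) ν) := by
    intro η
    by_cases h : η ∈ I
    · have hηB : η ∉ B := fun h' => h.2.1 η h' List.prefix_rfl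
      obtain ⟨m, hm⟩ : ∃ m, rem η = m + 1 := by
        cases hr : rem η with
        | zero =>
          have := h.2.2
          rw [hr, hb] at this
          simp [itr, hηB] at this
        | succ m => exact ⟨m, rfl⟩
      have hpos := h.2.2
      rw [hm] at hpos
      obtain ⟨s, hs, h1, h2, -, h4⟩ := itr_pos_succ hG p _ _ _ m hηB h.1 hpos
      have hrem : ∀ ν ∈ s.pos, rem ν = m := by
        intro ν hν
        have := (child_mem p h.1 (hG.sig_pos _ _ hs hν)).2.2
        have hle : k ≤ η.length := (p.root_le η h.1).length_le
        simp only [rem] at hm ⊢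
        omega
      refine ⟨s, fun _ => ⟨hs, h1, ?_, ?_⟩⟩
      · intro ν hν; rw [hrem ν hν]; exact h2 ν hν
      · rw [hm, hb, h4]
        apply le_of_eq
        apply hG.F_congr
        intro ν hν
        rw [hrem ν hν]
    · exact ⟨p.c η, fun h' => absurd h' h⟩
  choose c1 hc1 using hstep
  let c : List ℕ → TCreature H := fun η =>
    if h : ∃ ν ∈ B, ν <+: η then (q h.choose).c η else c1 η
  let g : List ℕ → ℝ := fun η =>
    if h : ∃ ν ∈ B, ν <+: η then muAt (q h.choose) η else b (rem η) η
  have hcO : ∀ {η ν}, ν ∈ B → ν <+: η → c η = (q ν).c η := by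
    intro η ν h1 h2
    have h : ∃ ν ∈ B, ν <+: η := ⟨ν, h1, h2⟩
    simp only [c, dif_pos h]
    rw [huniq h.choose_spec.1 h1 h.choose_spec.2 h2]
  have hgO : ∀ {η ν}, ν ∈ B → ν <+: η → g η = muAt (q ν) η := by
    intro η ν h1 h2
    have h : ∃ ν ∈ B, ν <+: η := ⟨ν, h1, h2⟩
    simp only [g, dif_pos h]
    rw [huniq h.choose_spec.1 h1 h.choose_spec.2 h2]
  have hno : ∀ {η}, η ∈ I → ¬ ∃ ν ∈ B, ν <+: η := by
    rintro η h ⟨ν, h1, h2⟩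
    exact h.2.1 ν h1 h2
  have hcI : ∀ {η}, η ∈ I → c η = c1 η := fun h => by simp only [c, dif_neg (hno h)]
  have hgI : ∀ {η}, η ∈ I → g η = b (rem η) η := fun h => by simp only [g, dif_neg (hno h)]
  have hqpre : ∀ {η ν}, ν ∈ B → η ∈ (q ν).tree → ν <+: η := fun h1 h2 =>
    ((hq _ h1).2.2.2.2.1 h2).2
  have hqp : ∀ {η ν}, ν ∈ B → η ∈ (q ν).tree → η ∈ p.tree := fun h1 h2 =>
    ((hq _ h1).2.2.2.2.1 h2).1
  have hqself : ∀ {ν}, ν ∈ B → ν ∈ (q ν).tree := by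
    intro ν h
    have := (q ν).root_mem
    rwa [(hq ν h).2.2.2.1] at this
  have hsig : ∀ η ∈ I ∪ O, η ∈ p.tree ∧ c η ∈ T.Sig (p.c η) := by
    rintro η (h | ⟨ν, h1, h2⟩)
    · rw [hcI h]; exact ⟨h.1, (hc1 η h).1⟩
    · rw [hcO h1 (hqpre h1 h2)]; exact ⟨hqp h1 h2, (hq ν h1).2.2.2.2.2.1 η h2⟩
  have hIchild : ∀ η ∈ I, ∀ ν ∈ (c η).pos, ν ∈ B ∨ ν ∈ I := by
    intro η h ν hν
    rw [hcI h] at hν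
    have hν' := hG.sig_pos _ _ (hc1 η h).1 hν
    by_cases hνB : ν ∈ B
    · exact Or.inl hνB
    · refine Or.inr ⟨(child_mem p h.1 hν').1, ?_, (hc1 η h).2.2.1 ν hν⟩
      intro σ hσ hσν
      obtain ⟨a, rfl⟩ := pos_form hν'
      rcases prefix_concat_cases hσν with h3 | h3
      · subst h3; exact hνB hσ
      · rw [p.c_node η h.1] at h3; exact h.2.1 σ hσ h3
  have hclosed : ∀ η ∈ I ∪ O, ∀ ν ∈ (c η).pos, ν ∈ I ∪ O := by
    rintro η (h | ⟨σ, h1, h2⟩) ν hν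
    · rcases hIchild η h ν hν with h3 | h3
      · exact Or.inr ⟨ν, h3, hqself h3⟩
      · exact Or.inl h3
    · rw [hcO h1 (hqpre h1 h2)] at hν
      exact Or.inr ⟨σ, h1, (child_mem (q σ) h2 hν).1⟩
  have hrem0 : rem p.root = N := by simp [rem, k]
  have hroot_good : p.root ∈ I ∪ O := by
    by_cases hr : p.root ∈ B
    · exact Or.inr ⟨_, hr, hqself hr⟩
    · refine Or.inl ⟨p.root_mem, ?_, by rw [hrem0]; exact hroot⟩
      intro ν hν h
      have : ν = p.root := List.IsPrefix.eq_of_length_le h (p.root_le ν (hB hν)).length_le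
      exact hr (this ▸ hν)
  obtain ⟨q', hqr, hqc, hqG⟩ := exists_gen T c p.root (I ∪ O) hroot_good
    (fun η h => hG.sig_mem _ (p.c_mem η (hsig η h).1) (hsig η h).2)
    (fun η h => by rw [hG.sig_node _ _ (hsig η h).2, p.c_node η (hsig η h).1]) hclosed
  have hO : ∀ {η ν}, η ∈ q'.tree → ν ∈ B → ν <+: η → η ∈ (q ν).tree := by
    intro η ν h1 h2 h3
    rcases hqG h1 with h | ⟨ν', h4, h5⟩
    · exact absurd h3 (h.2.1 ν h2)
    · rwa [huniq h2 h4 h3 (hqpre h4 h5)]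
  have hgmem : ∀ η ∈ I ∪ O, g η ∈ Set.Icc (0:ℝ) 1 := by
    rintro η (h | ⟨ν, h1, h2⟩)
    · rw [hgI h]; exact hBm _ _
    · rw [hgO h1 (hqpre h1 h2)]; exact muAt_mem hG hN _ h2
  have hgpos : ∀ η ∈ I ∪ O, 0 < g η := by
    rintro η (h | ⟨ν, h1, h2⟩)
    · rw [hgI h]; exact h.2.2
    · rw [hgO h1 (hqpre h1 h2)]; exact (hq ν h1).2.2.1 η h2
  have hgB : ∀ ν ∈ B, e ≤ g ν := by
    intro ν h
    rw [hgO h List.prefix_rfl]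
    have := (hq ν h).2.2.2.2.2.2
    rwa [muF, (hq ν h).2.2.2.1] at this
  have hgsub : ∀ η ∈ q'.tree, g η ≤ T.F (q'.c η) g := by
    intro η hη
    rw [hqc]
    rcases hqG hη with h | ⟨ν, h1, h2⟩
    · have hch := hIchild η h
      have hcl := hclosed η (Or.inl h)
      have hK := hG.sig_mem _ (p.c_mem η (hsig η (Or.inl h)).1) (hsig η (Or.inl h)).2
      rw [hgI h]
      rw [hcI h] at hch hcl hK ⊢
      refine (hc1 η h).2.2.2.trans (hN.mono _ hK _ _ (fun ν _ => hBm _ _)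
        (fun ν hν => hgmem ν (hcl ν hν)) ?_)
      intro ν hν
      rcases hch ν hν with h3 | h3
      · rw [hb, itr_of_mem p _ _ _ _ h3]; exact hgB ν h3
      · rw [hgI h3]
    · rw [hcO h1 (hqpre h1 h2), hgO h1 (hqpre h1 h2)]
      refine (muAt_sub hG hN (q ν) h2).trans_eq (hG.F_congr _ _ _ ?_)
      intro σ hσ
      rw [hgO h1 (hqpre h1 (child_mem (q ν) h2 hσ).1)]
  have hmu : ∀ η ∈ q'.tree, g η ≤ muAt q' η := fun η hη =>
    le_muAt_of_sub hG hN q' g (fun η h => hgmem η (hqG h)) hgsub hη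
  have hnorm : Normal q' := fun η hη => (hgpos η (hqG hη)).trans_le (hmu η hη)
  have hhit : ∀ x, IsBranchAt q' q'.root x → ∃ n, q'.root.length ≤ n ∧
      initSeg x n ∈ q'.tree ∩ B := by
    intro x hx
    have hmem := hx.2 (k + N) (by rw [hqr]; simp [k])
    rcases hqG hmem with h | ⟨ν, h1, h2⟩
    · exfalso
      have hz : rem (initSeg x (k+N)) = 0 := by simp [rem, initSeg_length]
      have hpos := h.2.2
      rw [hz, hb] at hpos
      have hnB : initSeg x (k+N) ∉ B := fun h' => h.2.1 _ h' List.prefix_rfl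
      simp [itr, hnB] at hpos
    · have hpre := hqpre h1 h2
      have hrt : q'.root <+: ν := by rw [hqr]; exact p.root_le ν (hB h1)
      have hν : ν ∈ q'.tree := q'.closed _ hmem _ hrt hpre
      refine ⟨ν.length, hrt.length_le, ?_⟩
      rw [← eq_initSeg_of_prefix hpre]
      exact ⟨hν, h1⟩
  have htree : ∀ ν ∈ q'.tree ∩ B, (q ν).tree = {ρ ∈ q'.tree | ν <+: ρ} := by
    rintro ν ⟨h1, h2⟩
    apply Set.Subset.antisymm
    · intro ρ hρ
      refine ⟨?_, hqpre h2 hρ⟩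
      refine cond_induct (q ν) (fun ρ => ρ ∈ q'.tree) ?_ ?_ ρ hρ
      · rw [(hq ν h2).2.2.2.1]; exact h1
      · intro η hη hη' σ hσ
        rw [← hcO h2 (hqpre h2 hη), ← hqc] at hσ
        exact (child_mem q' hη' hσ).1
    · rintro ρ ⟨h3, h4⟩
      exact hO h3 h2 h4
  refine ⟨q', ?_, hnorm _ q'.root_mem, hnorm, ⟨fun η h => (hsig η (hqG h)).1, ?_⟩, hqr, ?_,
    ⟨fun ρ h => ⟨h.1, q'.root_le _ h.1⟩, fun x hx => ?_⟩, ?_, ?_⟩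
  · intro n
    refine ⟨{ν | ν ∈ q'.tree ∧ ∀ ρ ∈ q'.tree, ν <+: ρ → (n:ℝ) ≤ (q'.c ρ).nor},
      ⟨fun ρ h => ⟨h.1, q'.root_le _ h.1⟩, ?_⟩, fun ν h => h.2⟩
    intro x hx
    obtain ⟨m, hm, hmt, hmB⟩ := hhit x hx
    set ν := initSeg x m with hν
    have hνl : ν.length = m := initSeg_length x m
    have hT := htree ν ⟨hmt, hmB⟩
    have hrt : (q ν).root = ν := (hq ν hmB).2.2.2.1
    obtain ⟨A, hA1, hA2⟩ := (hq ν hmB).1 n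
    obtain ⟨j, hj⟩ := hA1.2 x ⟨by rw [hrt, hνl], by
      intro i hi
      rw [hrt, hνl] at hi
      rw [hT]
      exact ⟨hx.2 i (hm.trans hi), initSeg_prefix x hi⟩⟩
    have hj1 := hA1.1 _ hj
    refine ⟨j, ?_, ?_⟩
    · have := hj1.1
      rw [hT] at this
      exact this.1
    · intro ρ hρ hpre
      have hνρ : ν <+: ρ := (hqpre hmB hj1.1).trans hpre
      have hρ' : ρ ∈ (q ν).tree := hO hρ hmB hνρ
      have := hA2 _ hj ρ hρ' hpre
      rwa [hqc, hcO hmB hνρ]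
  · intro η h
    rw [hqc]; exact (hsig η (hqG h)).2
  · have h1 := hmu q'.root q'.root_mem
    refine le_trans ?_ h1
    rw [hqr]
    by_cases hr : p.root ∈ B
    · rw [hb, itr_of_mem p _ _ _ _ hr]; exact hgB _ hr
    · have : p.root ∈ I := by
        refine ⟨p.root_mem, ?_, by rw [hrem0]; exact hroot⟩
        intro ν hν h
        have : ν = p.root := List.IsPrefix.eq_of_length_le h (p.root_le ν (hB hν)).length_le
        exact hr (this ▸ hν)
      rw [hgI this, hrem0]
  · obtain ⟨n, _, hn⟩ := hhit x hx
    exact ⟨n, hn⟩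
  · intro ν hν
    refine ⟨htree ν hν, fun ρ hρ => ?_⟩
    rw [hqc, hcO hν.2 (hqpre hν.2 hρ)]
  · rintro η hη ⟨ν, hν, hpre, hne⟩
    rcases hqG hη with h | ⟨ν', h1, h2⟩
    · rw [hqc, hcI h]; exact (hc1 η h).2.1
    · exfalso
      have h3 := hqpre h1 h2
      have h4 := hBanti _ h1 _ hν (h3.trans hpre)
      subst h4
      exact hne (List.IsPrefix.eq_of_length_le hpre h3.length_le)

/-- Lemma `useful`: given a normal `p ∈ Q^mt_4` with large measure
and norms, an antichain `B` of its tree, and normal conditions `q_ν ≥ p^{[ν]}`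
(`ν ∈ B`) of measure `≥ 1 − ε`, either `p` can be strengthened (keeping the root)
avoiding `B`, or it can be strengthened so that `B` becomes a front, below which the
condition agrees with the `q_ν` and above which norms drop by at most `2`. -/
theorem avoid_or_capture_antichain
    (T : MTriple H) (hG : T.Good) (hN : T.Nice)
    (p : Cond T) (hp4 : Qtree4 p) (hpμ : 0 < muF p) (hpn : Normal p)
    (hphalf : 1 / 2 < muF p)
    (hpnor : ∀ η ∈ p.tree, 2 < (p.c η).nor)
    (hk0 : 4 < p.root.length)
    (ε : ℝ) (hε0 : 0 < ε) (hε1 : ε ≤ ((2 : ℝ) ^ (1 + p.root.length))⁻¹)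
    (B : Set (List ℕ)) (hB : B ⊆ p.tree)
    (hBanti : ∀ ν ∈ B, ∀ ν' ∈ B, ν <+: ν' → ν = ν')
    (q : List ℕ → Cond T)
    (hq : ∀ ν ∈ B,
      Qtree4 (q ν) ∧ 0 < muF (q ν) ∧ Normal (q ν) ∧ (q ν).root = ν ∧
      (q ν).tree ⊆ {ρ ∈ p.tree | ν <+: ρ} ∧
      (∀ η ∈ (q ν).tree, (q ν).c η ∈ T.Sig (p.c η)) ∧
      1 - ε ≤ muF (q ν)) :
    (∃ q' : Cond T, Qtree4 q' ∧ 0 < muF q' ∧ Normal q' ∧ CondLe p q' ∧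
      q'.root = p.root ∧ ∀ ν ∈ B, ν ∉ q'.tree) ∨
    (∃ q' : Cond T, Qtree4 q' ∧ 0 < muF q' ∧ Normal q' ∧ CondLe p q' ∧
      q'.root = p.root ∧
      (1 - ((2 : ℝ) ^ p.root.length)⁻¹) * muF p ≤ muF q' ∧
      IsFrontAt q' q'.root (q'.tree ∩ B) ∧
      (∀ ν ∈ q'.tree ∩ B,
        (q ν).tree = {ρ ∈ q'.tree | ν <+: ρ} ∧
        ∀ ρ ∈ (q ν).tree, (q ν).c ρ = q'.c ρ) ∧
      (∀ η ∈ q'.tree, (∃ ν ∈ B, η <+: ν ∧ η ≠ ν) →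
        (p.c η).nor - 2 ≤ (q'.c η).nor)) := by
  by_cases hA : ∀ n, 0 < itr p B (fun η => sx η.length ^ 2) 0 1 n p.root
  · left
    refine avoid_case hG hN p hp4 B _ (fun η _ => pow_pos (sx_pos _) 2) (fun η hη => ?_) hA
    have h1 := sx_small (hk0.trans_le (p.root_le η hη).length_le)
    have h2 := sx_pos η.length
    nlinarith
  · right
    push Not at hA
    obtain ⟨N, hA⟩ := hA
    have hy := inv_two_pow_small hk0
    have hsb := sx_bound hk0
    have hs0 := sx_pos p.root.length
    have hε2 : ε ≤ ((2:ℝ) ^ p.root.length)⁻¹ / 2 := by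
      refine hε1.trans_eq ?_
      rw [pow_add, pow_one, mul_inv]; ring
    have hstep := main_step hG hN p hpnor hk0 B (1 - ε) (by linarith) (by linarith) N p.root
      p.root_mem (by unfold muF at hphalf; linarith)
    change _ * muF p ≤ _ at hstep
    have hconst : (1 - ((2 : ℝ) ^ p.root.length)⁻¹) * muF p ≤
        (1 - ε) * (1 - 8 * sx p.root.length) * muF p := by
      apply mul_le_mul_of_nonneg_right _ hpμ.le
      nlinarith [mul_pos hε0 hs0]
    have hge : (1 - ((2 : ℝ) ^ p.root.length)⁻¹) * muF p ≤
        itr p B (fun _ => 0) (1 - ε) 0 N p.root := by linarith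
    have hpos : 0 < (1 - ((2 : ℝ) ^ p.root.length)⁻¹) * muF p :=
      mul_pos (by linarith) hpμ
    obtain ⟨q', h1, h2, h3, h4, h5, h6, h7⟩ := capture_case hG hN p B (1 - ε) (by linarith)
      (by linarith) hB hBanti q hq N (hpos.trans_le hge)
    exact ⟨q', h1, h2, h3, h4, h5, hge.trans h6, h7⟩

end MeasuredTrees
end

section
/- Suppose p ∈ Q^mt_4(K*,Σ*,F*), let q be the cover of p, and let C ⊆ [T^p] be a closed subset of the branch space [T^q] with λ_q(C) > 0. Then there is a condition p* ∈ Q^mt_4(K*,Σ*,F*) with p ≤ p* and [T^{p*}] ⊆ C. -/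
open MeasureTheory

namespace ConcreteForcing

/-- The condition on the parameter function `φ_k`:
`φ_k(0) = 2^(k+4)` and
`φ_k(i+1) > 2^(2^(k+3)) + φ_k(i) + 2^(2k+7)/log₂(1 + 2^(−2^(2k+7)))`. -/
def PhiCond (k : ℕ) (φ : ℕ → ℕ) : Prop :=
  φ 0 = 2 ^ (k + 4) ∧
  ∀ i : ℕ, (φ (i + 1) : ℝ) >
    (2 : ℝ) ^ (2 ^ (k + 3)) + (φ i : ℝ) +
      (2 : ℝ) ^ (2 * k + 7) / Real.logb 2 (1 + ((2 : ℝ) ^ (2 ^ (2 * k + 7)))⁻¹)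

/-- `N_k = 2^(1+⌊log₂ φ_k(k+1)⌋)` for the family `φ` (where `φ k` is `φ_k`). -/
def Nval (φ : ℕ → ℕ → ℕ) (k : ℕ) : ℕ := 2 ^ (1 + Nat.log 2 (φ k (k + 1)))

/-- A member of `H*(k)`, i.e. a function `{0,…,N_k−1} → {0,1}`, is encoded by a
natural number `m < 2^(N_k)` via its binary digits: the function `i ↦ m.testBit i`.
`ExtendsNum g m` says that the total function encoded by `m` extends the partial
function `g`. -/
def ExtendsNum (g : ℕ → Option Bool) (m : ℕ) : Prop :=
  ∀ (i : ℕ) (b : Bool), g i = some b → m.testBit i = b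

/-- Extension of partial functions: `g ⊆ g'`. -/
def ExtendsP (g g' : ℕ → Option Bool) : Prop :=
  ∀ (i : ℕ) (b : Bool), g i = some b → g' i = some b

/-- The domain of a partial function `g` from `{0,…,N−1}` to `{0,1}`. -/
def pdom (N : ℕ) (g : ℕ → Option Bool) : Finset ℕ :=
  (Finset.range N).filter fun i => (g i).isSome

/-- A creature of `K*`: a valid node `η_t` (of some length `k`, with entries encoding
members of `H*(i)`), a norm `n_t ≤ k`, a partial function `g_t` from
`{0,…,N_k−1}` to `{0,1}` with `|dom g_t| ≤ φ_k(k − n_t)`, and a nonempty set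
`P_t` of (codes of) members of `H*(k)` extending `g_t`. -/
structure Crea (φ : ℕ → ℕ → ℕ) where
  node : List ℕ
  node_ok : ∀ (i : ℕ) (h : i < node.length), node.get ⟨i, h⟩ < 2 ^ Nval φ i
  n : ℕ
  g : ℕ → Option Bool
  P : Finset ℕ
  n_le : n ≤ node.length
  g_none : ∀ i : ℕ, Nval φ node.length ≤ i → g i = none
  g_card : (pdom (Nval φ node.length) g).card ≤ φ node.length (node.length - n)
  P_ne : P.Nonempty
  P_ok : ∀ m ∈ P, m < 2 ^ Nval φ node.length ∧ ExtendsNum g m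

/-- `pos(t)`: the set of one-step extensions of the node of `t` by members of `P_t`. -/
def Crea.pos {φ : ℕ → ℕ → ℕ} (t : Crea φ) : Finset (List ℕ) :=
  t.P.image fun m => t.node ++ [m]

/-- `s ∈ Σ*(t)`. -/
def SigR {φ : ℕ → ℕ → ℕ} (s t : Crea φ) : Prop :=
  s.node = t.node ∧ s.n ≤ t.n ∧ ExtendsP t.g s.g ∧ s.P ⊆ t.P

open Classical in
/-- The averaging function `F*_t`:
`min { 2^(|dom h|−N_k) · Σ{ r_ν : ν ∈ pos(t), h ⊆ ν(k) } : g_t ⊆ h, |dom h ∖ dom g_t| ≤ 2^(k+3) }`. -/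
noncomputable def Fst {φ : ℕ → ℕ → ℕ} (t : Crea φ) (r : List ℕ → ℝ) : ℝ :=
  sInf {v : ℝ | ∃ h : ℕ → Option Bool,
    ExtendsP t.g h ∧ (∀ i : ℕ, Nval φ t.node.length ≤ i → h i = none) ∧
    (pdom (Nval φ t.node.length) h \ pdom (Nval φ t.node.length) t.g).card ≤
      2 ^ (t.node.length + 3) ∧
    v = (2 : ℝ) ^ (((pdom (Nval φ t.node.length) h).card : ℤ) -
          (Nval φ t.node.length : ℤ)) *
        ∑ m ∈ t.P, (if ExtendsNum h m then r (t.node ++ [m]) else 0)}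

/-- A condition of `Q^tree_∅(K*,Σ*)`. -/
structure Cond (φ : ℕ → ℕ → ℕ) where
  tree : Set (List ℕ)
  root : List ℕ
  root_mem : root ∈ tree
  root_le : ∀ η ∈ tree, root <+: η
  closed : ∀ η ∈ tree, ∀ ν : List ℕ, root <+: ν → ν <+: η → ν ∈ tree
  c : List ℕ → Crea φ
  c_node : ∀ η ∈ tree, (c η).node = η
  succ_eq : ∀ η ∈ tree, ∀ ν : List ℕ,
    ((ν ∈ tree ∧ η <+: ν ∧ ν.length = η.length + 1) ↔ ν ∈ (c η).pos)

variable {φ : ℕ → ℕ → ℕ}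

/-- The initial segment of length `n` of an infinite sequence. -/
def initSeg (x : ℕ → ℕ) (n : ℕ) : List ℕ := (List.range n).map x

/-- `x` is an ω-branch of the tree of `p` through the node `η`. -/
def IsBranchAt (p : Cond φ) (η : List ℕ) (x : ℕ → ℕ) : Prop :=
  initSeg x η.length = η ∧ ∀ n : ℕ, η.length ≤ n → initSeg x n ∈ p.tree

/-- `A` is a front of the tree of `p^{[η]}`. -/
def IsFrontAt (p : Cond φ) (η : List ℕ) (A : Set (List ℕ)) : Prop :=
  (∀ ρ ∈ A, ρ ∈ p.tree ∧ η <+: ρ) ∧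
  ∀ x : ℕ → ℕ, IsBranchAt p η x → ∃ n : ℕ, initSeg x n ∈ A

/-- `ρ ∈ T[p^{[η]}, A]`. -/
def InCone (p : Cond φ) (η : List ℕ) (A : Set (List ℕ)) (ρ : List ℕ) : Prop :=
  ρ ∈ p.tree ∧ η <+: ρ ∧ ∃ ν ∈ A, ρ <+: ν

/-- `m` is the function `μ^f_{p^{[η]},A}` (extended by `0` off `T[p^{[η]},A]`). -/
def IsMuAt (p : Cond φ) (η : List ℕ) (A : Set (List ℕ))
    (f : List ℕ → ℝ) (m : List ℕ → ℝ) : Prop :=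
  (∀ ρ ∈ A, m ρ = f ρ) ∧
  (∀ ρ : List ℕ, InCone p η A ρ → ρ ∉ A → m ρ = Fst (p.c ρ) m) ∧
  (∀ ρ : List ℕ, ¬ InCone p η A ρ → m ρ = 0)

/-- `μ^{F*}_p(η)`: the infimum over fronts `A` of `p^{[η]}` of `μ^{1_A}_{p^{[η]},A}(η)`. -/
noncomputable def muAt (p : Cond φ) (η : List ℕ) : ℝ :=
  sInf {x : ℝ | ∃ (A : Set (List ℕ)) (m : List ℕ → ℝ),
    IsFrontAt p η A ∧ IsMuAt p η A (fun _ => 1) m ∧ x = m η}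

/-- `μ^{F*}(p)`. -/
noncomputable def muF (p : Cond φ) : ℝ := muAt p p.root

/-- The norm condition (c)₄ defining `Q^tree_4(K*,Σ*)`. -/
def Qtree4 (p : Cond φ) : Prop :=
  ∀ n : ℕ, ∃ A : Set (List ℕ), IsFrontAt p p.root A ∧
    ∀ ν ∈ A, ∀ ρ ∈ p.tree, ν <+: ρ → n ≤ (p.c ρ).n

/-- The order on conditions. -/
def CondLe (p q : Cond φ) : Prop :=
  q.tree ⊆ p.tree ∧ ∀ η ∈ q.tree, SigR (q.c η) (p.c η)

/-- `q` is the cover of `p`. -/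
def IsCover (p q : Cond φ) : Prop :=
  q.root = p.root ∧ p.tree ⊆ q.tree ∧
  (∀ η ∈ p.tree,
    (q.c η).n = (p.c η).n ∧ (q.c η).g = (p.c η).g ∧
    ∀ m : ℕ, m ∈ (q.c η).P ↔
      (m < 2 ^ Nval φ η.length ∧ ExtendsNum (p.c η).g m)) ∧
  (∀ η ∈ q.tree, η ∉ p.tree →
    (q.c η).n = η.length ∧ (∀ i : ℕ, (q.c η).g i = none) ∧
    ∀ m : ℕ, m ∈ (q.c η).P ↔ m < 2 ^ Nval φ η.length)

/-- The branch space `[T^q]`. -/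
def BranchSet (q : Cond φ) : Set (ℕ → ℕ) := {x : ℕ → ℕ | IsBranchAt q q.root x}

/-- The average of `r` over the total functions extending `h`. -/
noncomputable def avg (N : ℕ) (r : ℕ → ℝ) (h : ℕ → Option Bool) : ℝ :=
  (2 : ℝ) ^ (((pdom N h).card : ℤ) - (N : ℤ)) *
    ∑ m ∈ Finset.range (2 ^ N), (open Classical in if ExtendsNum h m then r m else 0)

lemma mem_pdom {N : ℕ} {h : ℕ → Option Bool} {i : ℕ} :
    i ∈ pdom N h ↔ i < N ∧ (h i).isSome := by
  simp [pdom]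

lemma pdom_update_some (N : ℕ) (h : ℕ → Option Bool) (i : ℕ) (hi : i < N) (b : Bool) :
    pdom N (Function.update h i (some b)) = insert i (pdom N h) := by
  ext j
  by_cases hj : j = i
  · subst hj; simp [mem_pdom, hi]
  · simp [mem_pdom, hj]

lemma extendsNum_update (h : ℕ → Option Bool) (i : ℕ) (hn : h i = none) (b : Bool) (m : ℕ) :
    ExtendsNum (Function.update h i (some b)) m ↔ (ExtendsNum h m ∧ m.testBit i = b) := by
  constructor
  · intro H
    refine ⟨fun j c hj => ?_, H i b (by simp)⟩
    have hji : j ≠ i := by rintro rfl; simp [hn] at hj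
    exact H j c (by simpa [hji] using hj)
  · rintro ⟨H, hb⟩ j c hj
    by_cases hji : j = i
    · subst hji; simp at hj; rw [hb, hj]
    · exact H j c (by simpa [hji] using hj)

lemma avg_split (N : ℕ) (r : ℕ → ℝ) (h : ℕ → Option Bool) (i : ℕ) (hi : i < N)
    (hn : h i = none) (b : Bool) :
    2 * avg N r h = avg N r (Function.update h i (some b)) +
      avg N r (Function.update h i (some (!b))) := by
  have hni : i ∉ pdom N h := by simp [mem_pdom, hn]
  unfold avg
  simp only [pdom_update_some N h i hi, Finset.card_insert_of_notMem hni]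
  rw [← mul_add, ← Finset.sum_add_distrib]
  have e : (2 : ℝ) ^ ((((pdom N h).card + 1 : ℕ) : ℤ) - (N : ℤ)) =
      2 * (2 : ℝ) ^ (((pdom N h).card : ℤ) - (N : ℤ)) := by
    rw [show ((((pdom N h).card + 1 : ℕ) : ℤ) - (N : ℤ)) = 1 + (((pdom N h).card : ℤ) - (N : ℤ)) by
      push_cast; ring, zpow_add₀ (by norm_num)]
    simp
  rw [e, mul_assoc]
  congr 2
  apply Finset.sum_congr rfl
  intro m _
  have e1 := extendsNum_update h i hn b m
  have e2 := extendsNum_update h i hn (!b) m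
  by_cases hm : ExtendsNum h m
  · by_cases hb : m.testBit i = b
    · have f1 := e1.2 ⟨hm, hb⟩
      have f2 : ¬ ExtendsNum (Function.update h i (some (!b))) m := by
        rw [e2, hb]; simp
      rw [if_pos hm, if_pos f1, if_neg f2, add_zero]
    · have f1 : ¬ ExtendsNum (Function.update h i (some b)) m := fun H => hb (e1.1 H).2
      have f2 : ExtendsNum (Function.update h i (some (!b))) m :=
        e2.2 ⟨hm, by cases b <;> simpa using hb⟩
      rw [if_pos hm, if_neg f1, if_pos f2, zero_add]
  · rw [if_neg hm, if_neg (fun H => hm (e1.1 H).1), if_neg (fun H => hm (e2.1 H).1), add_zero]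

lemma avg_one (N : ℕ) (h : ℕ → Option Bool) (hN : ∀ i, N ≤ i → h i = none) :
    avg N (fun _ => 1) h = 1 := by
  induction hd : N - (pdom N h).card generalizing h with
  | zero =>
    have hsub : pdom N h ⊆ Finset.range N := Finset.filter_subset _ _
    have hc : (pdom N h).card ≤ N := by simpa using Finset.card_le_card hsub
    have hcN : (pdom N h).card = N := by omega
    have heq : pdom N h = Finset.range N := Finset.eq_of_subset_of_card_le hsub (by simp [hcN])
    have hall : ∀ i, i < N → ∃ b, h i = some b := fun i hi => by
      have : i ∈ pdom N h := by rw [heq]; simpa using hi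
      exact Option.isSome_iff_exists.1 (mem_pdom.1 this).2
    unfold avg
    rw [hcN]
    simp only [sub_self, zpow_zero, one_mul]
    have : ∃ m0, m0 < 2 ^ N ∧ ExtendsNum h m0 := by
      refine ⟨Nat.ofBits (fun i : Fin N => (h i).getD false), Nat.ofBits_lt_two_pow _, ?_⟩
      intro i b hb
      have hi : i < N := by
        by_contra hc
        rw [hN i (by omega)] at hb; cases hb
      rw [Nat.testBit_ofBits_lt _ _ hi]
      simp [hb]
    obtain ⟨m0, hm0, hE⟩ := this
    rw [Finset.sum_eq_single m0]
    · simp [hE]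
    · intro m hm hne
      rw [if_neg]
      intro hEm
      apply hne
      apply Nat.eq_of_testBit_eq
      intro i
      by_cases hi : i < N
      · obtain ⟨b, hb⟩ := hall i hi
        rw [hE i b hb, hEm i b hb]
      · have hp : 2 ^ N ≤ 2 ^ i := Nat.pow_le_pow_right (by norm_num) (by omega)
        rw [Nat.testBit_eq_false_of_lt (lt_of_lt_of_le (Finset.mem_range.1 hm) hp),
          Nat.testBit_eq_false_of_lt (lt_of_lt_of_le hm0 hp)]
    · intro hn; exact absurd (Finset.mem_range.2 hm0) hn
  | succ n ih =>
    have : ∃ i, i < N ∧ h i = none := by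
      by_contra hcon
      push Not at hcon
      have : pdom N h = Finset.range N := by
        ext i
        simp only [mem_pdom, Finset.mem_range, and_iff_left_iff_imp]
        intro hi
        exact Option.isSome_iff_ne_none.2 (hcon i hi)
      rw [this] at hd; simp at hd
    obtain ⟨i, hi, hn⟩ := this
    have hni : i ∉ pdom N h := by simp [mem_pdom, hn]
    have key : ∀ b, avg N (fun _ => 1) (Function.update h i (some b)) = 1 := by
      intro b
      apply ih
      · intro j hj
        have : j ≠ i := by omega
        simp [this, hN j hj]
      · rw [pdom_update_some N h i hi, Finset.card_insert_of_notMem hni]; omega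
    have := avg_split N (fun _ => 1) h i hi hn true
    rw [key, key] at this
    linarith

lemma avg_mono (N : ℕ) (r r' : ℕ → ℝ) (hr : ∀ m, r m ≤ r' m) (h : ℕ → Option Bool) :
    avg N r h ≤ avg N r' h := by
  unfold avg
  apply mul_le_mul_of_nonneg_left _ (by positivity)
  apply Finset.sum_le_sum
  intro m _
  split_ifs
  · exact hr m
  · exact le_rfl

lemma avg_le_one (N : ℕ) (r : ℕ → ℝ) (hr : ∀ m, r m ≤ 1) (h : ℕ → Option Bool)
    (hN : ∀ i, N ≤ i → h i = none) : avg N r h ≤ 1 := by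
  rw [← avg_one N h hN]
  exact avg_mono N r _ hr h

lemma extendsP_refl (h : ℕ → Option Bool) : ExtendsP h h := fun _ _ H => H

lemma ExtendsP.trans {a b c : ℕ → Option Bool} (h1 : ExtendsP a b) (h2 : ExtendsP b c) :
    ExtendsP a c := fun i v H => h2 i v (h1 i v H)

lemma pdom_mono (N : ℕ) {a b : ℕ → Option Bool} (h1 : ExtendsP a b) : pdom N a ⊆ pdom N b := by
  intro i hi
  rw [mem_pdom] at hi ⊢
  obtain ⟨v, hv⟩ := Option.isSome_iff_exists.1 hi.2
  exact ⟨hi.1, by rw [h1 i v hv]; rfl⟩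

lemma finite_partial (N : ℕ) : {h : ℕ → Option Bool | ∀ i, N ≤ i → h i = none}.Finite := by
  apply (Set.finite_range (fun (f : Fin N → Option Bool) (i : ℕ) =>
    if hi : i < N then f ⟨i, hi⟩ else none)).subset
  intro h hh
  refine ⟨fun i => h i, ?_⟩
  ext1 i
  by_cases hi : i < N
  · simp [hi]
  · simp [hi, hh i (by omega)]

lemma exists_max (N : ℕ) (r : ℕ → ℝ) (β : ℝ) (hβ : 0 < β) (g : ℕ → Option Bool)
    (hg : ∀ i, N ≤ i → g i = none) :
    ∃ g', ExtendsP g g' ∧ (∀ i, N ≤ i → g' i = none) ∧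
      ∀ h, ExtendsP g h → (∀ i, N ≤ i → h i = none) →
        avg N r h * β ^ (pdom N g').card ≤ avg N r g' * β ^ (pdom N h).card := by
  have hf : {h : ℕ → Option Bool | (∀ i, N ≤ i → h i = none) ∧ ExtendsP g h}.Finite :=
    (finite_partial N).subset (fun h hh => hh.1)
  obtain ⟨g', hg', hmax⟩ := Set.exists_max_image _ (fun h => avg N r h / β ^ (pdom N h).card) hf
    ⟨g, hg, extendsP_refl g⟩
  refine ⟨g', hg'.2, hg'.1, fun h h1 h2 => ?_⟩
  have := hmax h ⟨h2, h1⟩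
  rwa [div_le_div_iff₀ (by positivity) (by positivity)] at this

lemma avg_lower (N : ℕ) (r : ℕ → ℝ) (β : ℝ) (hβ : 1 ≤ β)
    (g : ℕ → Option Bool) (h0 : 0 ≤ avg N r g)
    (hmax : ∀ h, ExtendsP g h → (∀ i, N ≤ i → h i = none) →
        avg N r h * β ^ (pdom N g).card ≤ avg N r g * β ^ (pdom N h).card)
    (j : ℕ) (h : ℕ → Option Bool) (hgh : ExtendsP g h) (hN : ∀ i, N ≤ i → h i = none)
    (hj : (pdom N h \ pdom N g).card = j) :
    (1 - (2 ^ j - 1) * (β ^ j - 1)) * avg N r g ≤ avg N r h := by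
  induction j generalizing h with
  | zero =>
    have : h = g := by
      ext1 i
      cases hgi : g i with
      | some b => exact hgh i b hgi
      | none =>
        by_cases hi : i < N
        · by_contra hne
          have : i ∈ pdom N h \ pdom N g := by
            simp [mem_pdom, hi, hgi, Option.isSome_iff_ne_none, hne]
          rw [Finset.card_eq_zero.1 hj] at this
          simp at this
        · exact hN i (by omega)
    subst this
    simp
  | succ j ih =>
    obtain ⟨i, hi⟩ : (pdom N h \ pdom N g).Nonempty := by
      rw [← Finset.card_pos]; omega
    have hi' := hi
    simp only [Finset.mem_sdiff, mem_pdom] at hi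
    obtain ⟨⟨hiN, hs⟩, hng⟩ := hi
    obtain ⟨b, hb⟩ := Option.isSome_iff_exists.1 hs
    have hgi : g i = none := by
      by_contra hne
      exact hng ⟨hiN, Option.isSome_iff_ne_none.2 hne⟩
    set u := Function.update h i none with hu
    have hui : u i = none := by simp [hu]
    have hhu : h = Function.update u i (some b) := by simp [hu, ← hb]
    have hgu : ExtendsP g u := by
      intro x c hx
      have : x ≠ i := by rintro rfl; simp [hgi] at hx
      simp [hu, this, hgh x c hx]
    have huN : ∀ x, N ≤ x → u x = none := by
      intro x hx
      have : x ≠ i := by omega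
      simp [hu, this, hN x hx]
    have hniu : i ∉ pdom N u := by simp [mem_pdom, hui]
    have hpd : pdom N h = insert i (pdom N u) := by
      conv_lhs => rw [hhu]
      rw [pdom_update_some N u i hiN]
    have hcu : (pdom N u \ pdom N g).card = j := by
      have : pdom N u \ pdom N g = (pdom N h \ pdom N g).erase i := by
        ext x
        simp only [hpd, Finset.mem_sdiff, Finset.mem_erase, Finset.mem_insert]
        constructor
        · rintro ⟨h1, h2⟩
          exact ⟨fun e => hniu (e ▸ h1), Or.inr h1, h2⟩
        · rintro ⟨h1, h2, h3⟩
          exact ⟨h2.resolve_left h1, h3⟩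
      rw [this, Finset.card_erase_of_mem hi', hj]; rfl
    have IH := ih u hgu huN hcu
    have sp := avg_split N r u i hiN hui b
    rw [← hhu] at sp
    set v := Function.update u i (some (!b)) with hv
    have hgv : ExtendsP g v := by
      intro x c hx
      have : x ≠ i := by rintro rfl; simp [hgi] at hx
      simp [hv, this, hgu x c hx]
    have hvN : ∀ x, N ≤ x → v x = none := by
      intro x hx
      have : x ≠ i := by omega
      simp [hv, this, huN x hx]
    have hvc : (pdom N v).card = (pdom N g).card + (j + 1) := by
      rw [hv, pdom_update_some N u i hiN, ← hpd, ← hj]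
      have := Finset.card_sdiff_add_card_eq_card (pdom_mono N hgh)
      omega
    have M := hmax v hgv hvN
    rw [hvc, pow_add, mul_comm (β ^ _), ← mul_assoc] at M
    have M' := le_of_mul_le_mul_right M (by positivity)
    have hb1 : 1 ≤ β ^ j := one_le_pow₀ hβ
    have hb2 : β ^ j ≤ β ^ (j + 1) := pow_le_pow_right₀ hβ (by omega)
    have h2 : (1 : ℝ) ≤ 2 ^ j := one_le_pow₀ (by norm_num)
    have : (1 - (2 ^ (j + 1) - 1) * (β ^ (j + 1) - 1)) ≤
        2 * (1 - (2 ^ j - 1) * (β ^ j - 1)) - β ^ (j + 1) := by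
      rw [pow_succ (2 : ℝ)]
      nlinarith
    nlinarith [mul_le_mul_of_nonneg_right this h0]

lemma beta_pow (x : ℝ) (h0 : 0 ≤ x) (h1 : x ≤ 1) (j : ℕ) :
    (1 + x) ^ j - 1 ≤ (2 ^ j - 1) * x := by
  induction j with
  | zero => simp
  | succ j ih =>
    have h2 : (1 : ℝ) ≤ 2 ^ j := one_le_pow₀ (by norm_num)
    rw [pow_succ, pow_succ]
    nlinarith [mul_nonneg (mul_nonneg (sub_nonneg.2 h2) h0) (sub_nonneg.2 h1)]

lemma numeric (k j : ℕ) (hj : j ≤ 2 ^ (k + 3)) :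
    ((2 : ℝ) ^ j - 1) * ((1 + ((2 : ℝ) ^ (2 ^ (2 * k + 7)))⁻¹) ^ j - 1) ≤ ((2 : ℝ) ^ (k + 3))⁻¹ := by
  set x := ((2 : ℝ) ^ (2 ^ (2 * k + 7)))⁻¹ with hx
  have hx0 : 0 ≤ x := by positivity
  have hx1 : x ≤ 1 := inv_le_one_of_one_le₀ (one_le_pow₀ (by norm_num))
  have h2 : (1 : ℝ) ≤ 2 ^ j := one_le_pow₀ (by norm_num)
  have hB := beta_pow x hx0 hx1 j
  have step1 : ((2 : ℝ) ^ j - 1) * ((1 + x) ^ j - 1) ≤ (2 ^ j * 2 ^ j) * x := by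
    calc _ ≤ ((2 : ℝ) ^ j - 1) * ((2 ^ j - 1) * x) := by
          apply mul_le_mul_of_nonneg_left hB; linarith
      _ ≤ _ := by
        rw [← mul_assoc]
        apply mul_le_mul_of_nonneg_right _ hx0
        nlinarith
  refine step1.trans ?_
  rw [hx, ← div_eq_mul_inv, div_le_iff₀ (by positivity), ← div_eq_inv_mul,
    le_div_iff₀ (by positivity), ← pow_add, ← pow_add]
  apply pow_le_pow_right₀ (by norm_num)
  have e1 : 2 ^ (2 * k + 7) = 16 * (2 ^ k * 2 ^ (k + 3)) := by
    rw [← pow_add, show 2 * k + 7 = 4 + (k + (k + 3)) by ring, pow_add]; norm_num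
  have e2 : k + 3 < 2 ^ (k + 3) := Nat.lt_two_pow_self
  have e3 : 1 ≤ 2 ^ k := Nat.one_le_two_pow
  have e4 : 2 ^ (k + 3) ≤ 2 ^ k * 2 ^ (k + 3) := Nat.le_mul_of_pos_left _ (by omega)
  omega

lemma size_bound (k i c c' : ℕ) (φ : ℕ → ℕ) (hφ : PhiCond k φ) (a : ℝ)
    (ha : ((2 : ℝ) ^ (2 ^ (k + 4) + 1))⁻¹ ≤ a) (hcc : c ≤ c') (hc : c ≤ φ i)
    (hb : a * (1 + ((2 : ℝ) ^ (2 ^ (2 * k + 7)))⁻¹) ^ c' ≤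
      (1 + ((2 : ℝ) ^ (2 ^ (2 * k + 7)))⁻¹) ^ c) : c' ≤ φ (i + 1) := by
  have H := hφ.2 i
  set β := 1 + ((2 : ℝ) ^ (2 ^ (2 * k + 7)))⁻¹ with hβ
  have hβ1 : 1 < β := by
    have : (0:ℝ) < ((2 : ℝ) ^ (2 ^ (2 * k + 7)))⁻¹ := by positivity
    linarith
  obtain ⟨d, rfl⟩ := Nat.exists_eq_add_of_le hcc
  have hpos : 0 < β ^ c := by positivity
  have h1 : a * β ^ d ≤ 1 := by
    rw [pow_add] at hb
    have : (a * β ^ d) * β ^ c ≤ 1 * β ^ c := by linarith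
    exact le_of_mul_le_mul_right this hpos
  have h2 : β ^ d ≤ 2 ^ (2 ^ (k + 4) + 1) := by
    have : ((2 : ℝ) ^ (2 ^ (k + 4) + 1))⁻¹ * β ^ d ≤ 1 :=
      (mul_le_mul_of_nonneg_right ha (by positivity)).trans h1
    rwa [← div_eq_inv_mul, div_le_one (by positivity)] at this
  have hl : 0 < Real.logb 2 β := Real.logb_pos (by norm_num) hβ1
  have h3 : (d : ℝ) * Real.logb 2 β ≤ (2 ^ (k + 4) + 1 : ℕ) := by
    have := Real.logb_le_logb_of_le (b := 2) (by norm_num) (by positivity) h2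
    rw [Real.logb_pow, Real.logb_pow, Real.logb_self_eq_one (by norm_num)] at this
    simpa using this
  have h4 : ((2 ^ (k + 4) + 1 : ℕ) : ℝ) ≤ 2 ^ (2 * k + 7) := by
    have e1 : 2 ^ (k + 4) + 1 ≤ 2 ^ (k + 5) := by
      have : 1 ≤ 2 ^ (k + 4) := Nat.one_le_two_pow
      rw [pow_succ 2 (k + 4)]; omega
    have e2 : 2 ^ (k + 5) ≤ 2 ^ (2 * k + 7) := Nat.pow_le_pow_right (by norm_num) (by omega)
    exact_mod_cast e1.trans e2
  have h5 : (d : ℝ) ≤ (2 : ℝ) ^ (2 * k + 7) / Real.logb 2 β := by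
    rw [le_div_iff₀ hl]; exact h3.trans h4
  have h6 : (0 : ℝ) ≤ (2 : ℝ) ^ (2 ^ (k + 3)) := by positivity
  have h7 : (c : ℝ) ≤ φ i := by exact_mod_cast hc
  have : ((c + d : ℕ) : ℝ) ≤ φ (i + 1) := by push_cast; linarith
  exact_mod_cast this

lemma avg_finset (N : ℕ) (P : Finset ℕ) (hP : ∀ m ∈ P, m < 2 ^ N) (f : ℕ → ℝ)
    (h : ℕ → Option Bool) :
    avg N (fun m => if m ∈ P then f m else 0) h =
      (2 : ℝ) ^ (((pdom N h).card : ℤ) - (N : ℤ)) *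
        ∑ m ∈ P, (open Classical in if ExtendsNum h m then f m else 0) := by
  unfold avg
  congr 1
  rw [← Finset.sum_subset (s₁ := P) (s₂ := Finset.range (2 ^ N))
    (fun m hm => Finset.mem_range.2 (hP m hm))]
  · exact Finset.sum_congr rfl fun m hm => by simp [hm]
  · intro m _ hm
    simp [hm]

lemma avg_add_const (N : ℕ) (r : ℕ → ℝ) (c : ℝ) (h : ℕ → Option Bool)
    (hN : ∀ i, N ≤ i → h i = none) : avg N (fun m => r m + c) h = avg N r h + c := by
  have h1 := avg_one N h hN
  have : avg N (fun m => r m + c) h = avg N r h + c * avg N (fun _ => 1) h := by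
    unfold avg
    rw [mul_left_comm, ← mul_add]
    congr 1
    rw [Finset.mul_sum, ← Finset.sum_add_distrib]
    apply Finset.sum_congr rfl
    intro m _
    split_ifs <;> simp
  rw [this, h1, mul_one]

/-- density thresholds -/
noncomputable def del (k : ℕ) : ℝ := ((2 : ℝ) ^ (2 ^ (k + 4)))⁻¹

/-- weights -/
noncomputable def cw (k : ℕ) : ℝ := 1 - ((2 : ℝ) ^ (k + 1))⁻¹

lemma del_pos (k : ℕ) : 0 < del k := by unfold del; positivity

lemma cw_pos (k : ℕ) : 0 < cw k := by
  unfold cw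
  have : ((2 : ℝ) ^ (k + 1))⁻¹ < 1 := inv_lt_one_of_one_lt₀ (one_lt_pow₀ (by norm_num) (by omega))
  linarith

lemma cw_le_one (k : ℕ) : cw k ≤ 1 := by
  unfold cw
  have : 0 < ((2 : ℝ) ^ (k + 1))⁻¹ := by positivity
  linarith

lemma del_succ (k : ℕ) : del (k + 1) ≤ ((2 : ℝ) ^ (k + 3))⁻¹ * del k := by
  unfold del
  rw [← mul_inv, ← pow_add]
  apply inv_anti₀ (by positivity)
  apply pow_le_pow_right₀ (by norm_num)
  have e1 : k + 3 < 2 ^ (k + 3) := Nat.lt_two_pow_self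
  have e2 : 2 ^ (k + 4) = 2 ^ (k + 3) * 2 := pow_succ _ _
  have e3 : 2 ^ (k + 1 + 4) = 2 ^ (k + 4) * 2 := pow_succ _ _
  omega

lemma cw_succ (k : ℕ) : cw k ≤ cw (k + 1) * (1 - ((2 : ℝ) ^ (k + 3))⁻¹) *
    (1 - ((2 : ℝ) ^ (k + 3))⁻¹) := by
  unfold cw
  set y := ((2 : ℝ) ^ (k + 3))⁻¹ with hy
  have e1 : ((2 : ℝ) ^ (k + 1))⁻¹ = 4 * y := by
    rw [hy, show k + 3 = (k + 1) + 2 by ring, pow_add _ (k + 1)]; field_simp; norm_num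
  have e2 : ((2 : ℝ) ^ (k + 1 + 1))⁻¹ = 2 * y := by
    rw [hy, show k + 3 = (k + 1 + 1) + 1 by ring, pow_add _ (k + 1 + 1)]; field_simp
  rw [e1, e2]
  have y0 : 0 < y := by positivity
  have y1 : y ≤ 1 / 8 := by
    rw [hy, one_div]
    apply inv_anti₀ (by norm_num)
    calc (8 : ℝ) = 2 ^ 3 := by norm_num
      _ ≤ _ := pow_le_pow_right₀ (by norm_num) (by omega)
  nlinarith [mul_pos y0 y0, mul_pos (mul_pos y0 y0) y0]

lemma step_crea {φ : ℕ → ℕ → ℕ} (hφ : ∀ k : ℕ, PhiCond k (φ k)) (t : Crea φ) (hn : 1 ≤ t.n)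
    (d : ℕ → ℝ) (d0 : ∀ m, 0 ≤ d m) (d1 : ∀ m, d m ≤ 1) (D : ℝ)
    (hDa : D ≤ (2 : ℝ) ^ (((pdom (Nval φ t.node.length) t.g).card : ℤ) -
      (Nval φ t.node.length : ℤ)) * ∑ m ∈ t.P, d m)
    (hD : del t.node.length ≤ D) :
    ∃ s : Crea φ, s.node = t.node ∧ SigR s t ∧ t.n ≤ s.n + 1 ∧
      (∀ m ∈ s.P, del (t.node.length + 1) ≤ d m) ∧
      ∀ r : List ℕ → ℝ, (∀ m ∈ s.P, cw (t.node.length + 1) * d m ≤ r (t.node ++ [m])) →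
        cw t.node.length * D ≤ Fst s r := by
  classical
  set k := t.node.length with hk
  set N := Nval φ k with hN
  have hPN : ∀ m ∈ t.P, m < 2 ^ N := fun m hm => (t.P_ok m hm).1
  set r' : ℕ → ℝ := fun m => if m ∈ t.P.filter (fun m => del (k + 1) ≤ d m) then d m else 0 with hr'
  set y := ((2 : ℝ) ^ (k + 3))⁻¹ with hy
  have y0 : 0 < y := by positivity
  have y1 : y ≤ 1 / 8 := by
    rw [hy, one_div]
    apply inv_anti₀ (by norm_num)
    calc (8 : ℝ) = 2 ^ 3 := by norm_num
      _ ≤ _ := pow_le_pow_right₀ (by norm_num) (by omega)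
  have hdk := del_pos k
  have hdk1 := del_pos (k + 1)
  have hr0 : ∀ m, 0 ≤ r' m := fun m => by
    simp only [hr']; split_ifs; exacts [d0 m, le_rfl]
  have hr1 : ∀ m, r' m ≤ 1 := fun m => by
    simp only [hr']; split_ifs; exacts [d1 m, zero_le_one]
  have ha : (1 - y) * D ≤ avg N r' t.g := by
    have A1 : avg N (fun m => if m ∈ t.P then d m else 0) t.g ≤ avg N (fun m => r' m + del (k + 1)) t.g := by
      apply avg_mono
      intro m
      simp only [hr', Finset.mem_filter]
      by_cases h1 : m ∈ t.P
      · by_cases h2 : del (k + 1) ≤ d m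
        · simp [h1, h2]; exact hdk1.le
        · simp [h1, h2]; linarith
      · simp [h1]; exact hdk1.le
    rw [avg_add_const _ _ _ _ t.g_none, avg_finset N t.P hPN] at A1
    have : ∑ m ∈ t.P, (if ExtendsNum t.g m then d m else 0) = ∑ m ∈ t.P, d m :=
      Finset.sum_congr rfl fun m hm => by rw [if_pos (t.P_ok m hm).2]
    rw [this] at A1
    have A2 := del_succ k
    nlinarith
  have hy' : 0 < 1 - y := by linarith
  have hDpos : 0 < D := by linarith
  set β := 1 + ((2 : ℝ) ^ (2 ^ (2 * k + 7)))⁻¹ with hβ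
  have hβ1 : 1 ≤ β := by
    have : (0:ℝ) < ((2 : ℝ) ^ (2 ^ (2 * k + 7)))⁻¹ := by positivity
    linarith
  obtain ⟨g', hg1, hg2, hmax⟩ := exists_max N r' β (by linarith) t.g t.g_none
  have hapos : 0 < avg N r' t.g := lt_of_lt_of_le (by positivity) ha
  have hcc : (pdom N t.g).card ≤ (pdom N g').card := Finset.card_le_card (pdom_mono N hg1)
  have hM := hmax t.g (extendsP_refl _) t.g_none
  have hag : avg N r' t.g ≤ avg N r' g' := by
    have : β ^ (pdom N t.g).card ≤ β ^ (pdom N g').card := pow_le_pow_right₀ hβ1 hcc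
    have h2 : avg N r' t.g * β ^ (pdom N t.g).card ≤ avg N r' g' * β ^ (pdom N t.g).card :=
      (mul_le_mul_of_nonneg_left this hapos.le).trans hM
    exact le_of_mul_le_mul_right h2 (by positivity)
  have hsize : (pdom N g').card ≤ φ k (k - t.n + 1) := by
    apply size_bound k (k - t.n) (pdom N t.g).card _ (φ k) (hφ k) (avg N r' t.g) _ hcc t.g_card
    · refine hM.trans ?_
      have := avg_le_one N r' hr1 g' hg2
      calc _ ≤ 1 * β ^ (pdom N t.g).card := mul_le_mul_of_nonneg_right this (by positivity)
        _ = _ := one_mul _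
    · have : ((2 : ℝ) ^ (2 ^ (k + 4) + 1))⁻¹ = del k / 2 := by
        rw [del, pow_succ, mul_inv]; ring
      rw [this]
      nlinarith
  have hpos' : 0 < avg N r' g' := lt_of_lt_of_le hapos hag
  set P' := (t.P.filter (fun m => del (k + 1) ≤ d m)).filter (fun m => ExtendsNum g' m) with hP'
  have hne : P'.Nonempty := by
    by_contra hcon
    rw [Finset.not_nonempty_iff_eq_empty] at hcon
    have : avg N r' g' = 0 := by
      unfold avg
      rw [Finset.sum_eq_zero, mul_zero]
      intro m _
      split_ifs with h1
      · simp only [hr']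
        rw [if_neg]
        intro h2
        have : m ∈ P' := Finset.mem_filter.2 ⟨h2, h1⟩
        rw [hcon] at this; simp at this
      · rfl
    linarith
  have hnle := t.n_le
  let s : Crea φ :=
    { node := t.node
      node_ok := t.node_ok
      n := t.n - 1
      g := g'
      P := P'
      n_le := by omega
      g_none := hg2
      g_card := by
        have : t.node.length - (t.n - 1) = k - t.n + 1 := by omega
        rw [this]; exact hsize
      P_ne := hne
      P_ok := fun m hm => by
        rw [hP', Finset.mem_filter, Finset.mem_filter] at hm
        exact ⟨hPN m hm.1.1, hm.2⟩ }
  refine ⟨s, rfl, ⟨rfl, Nat.sub_le _ _, hg1, ?_⟩, ?_, ?_, ?_⟩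
  · intro m hm
    exact (Finset.mem_filter.1 (Finset.mem_filter.1 hm).1).1
  · show t.n ≤ t.n - 1 + 1
    omega
  · intro m hm
    exact (Finset.mem_filter.1 (Finset.mem_filter.1 hm).1).2
  · intro r hr
    apply le_csInf
    · exact ⟨_, g', extendsP_refl _, hg2, by simp [s], rfl⟩
    · rintro v ⟨h, h1, h2, h3, rfl⟩
      change ExtendsP g' h at h1
      change ∀ i, N ≤ i → h i = none at h2
      change (pdom N h \ pdom N g').card ≤ 2 ^ (k + 3) at h3
      change _ ≤ (2 : ℝ) ^ (((pdom N h).card : ℤ) - (N : ℤ)) *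
        ∑ m ∈ P', (if ExtendsNum h m then r (t.node ++ [m]) else 0)
      have L := avg_lower N r' β hβ1 g' hpos'.le
        (fun u hu1 hu2 => hmax u (hg1.trans hu1) hu2) _ h h1 h2 rfl
      have L2 := numeric k _ h3
      rw [← hβ, ← hy] at L2
      have L3 : (1 - y) * avg N r' g' ≤ avg N r' h :=
        le_trans (mul_le_mul_of_nonneg_right (by linarith) hpos'.le) L
      have L4 : avg N r' h = (2 : ℝ) ^ (((pdom N h).card : ℤ) - (N : ℤ)) *
        ∑ m ∈ P', (if ExtendsNum h m then d m else 0) := by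
        rw [hr', avg_finset N _ (fun m hm => hPN m (Finset.mem_filter.1 hm).1)]
        congr 1
        symm
        apply Finset.sum_subset (Finset.filter_subset _ _)
        intro m hm hm'
        rw [if_neg]
        intro hE
        apply hm'
        exact Finset.mem_filter.2 ⟨hm, fun i b hb => hE i b (h1 i b hb)⟩
      have L5 : cw (k + 1) * avg N r' h ≤ (2 : ℝ) ^ (((pdom N h).card : ℤ) - (N : ℤ)) *
        ∑ m ∈ P', (if ExtendsNum h m then r (t.node ++ [m]) else 0) := by
        rw [L4, mul_left_comm]
        apply mul_le_mul_of_nonneg_left _ (by positivity)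
        rw [Finset.mul_sum]
        apply Finset.sum_le_sum
        intro m hm
        split_ifs
        · exact hr m hm
        · simp
      refine le_trans ?_ L5
      have hc := cw_pos (k + 1)
      calc cw k * D ≤ cw (k + 1) * (1 - y) * (1 - y) * D :=
            mul_le_mul_of_nonneg_right (cw_succ k) hDpos.le
        _ = cw (k + 1) * ((1 - y) * ((1 - y) * D)) := by ring
        _ ≤ cw (k + 1) * ((1 - y) * avg N r' g') := by
            apply mul_le_mul_of_nonneg_left _ hc.le
            exact mul_le_mul_of_nonneg_left (ha.trans hag) hy'.le
        _ ≤ cw (k + 1) * avg N r' h := mul_le_mul_of_nonneg_left L3 hc.le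

lemma initSeg_succ (x : ℕ → ℕ) (n : ℕ) : initSeg x (n + 1) = initSeg x n ++ [x n] := by
  simp [initSeg, List.range_succ]

lemma initSeg_length (x : ℕ → ℕ) (n : ℕ) : (initSeg x n).length = n := by
  simp [initSeg]

lemma initSeg_prefix (x : ℕ → ℕ) {a b : ℕ} (h : a ≤ b) : initSeg x a <+: initSeg x b := by
  induction h with
  | refl => exact List.prefix_rfl
  | step _ ih => rw [Nat.succ_eq_add_one, initSeg_succ]; exact ih.trans (List.prefix_append _ _)

lemma initSeg_eq_of_prefix (x : ℕ → ℕ) (ν : List ℕ) (n : ℕ) (h : ν <+: initSeg x n) :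
    initSeg x ν.length = ν := by
  have hl := h.length_le
  rw [initSeg_length] at hl
  have h2 := initSeg_prefix x hl
  have := List.prefix_of_prefix_length_le h2 h (by rw [initSeg_length])
  exact this.eq_of_length (by rw [initSeg_length])

lemma exists_branch (Q : List ℕ → Prop) (ρ : List ℕ) (h0 : Q ρ)
    (hs : ∀ η, Q η → ∃ m, Q (η ++ [m])) :
    ∃ x : ℕ → ℕ, initSeg x ρ.length = ρ ∧ ∀ n, ρ.length ≤ n → Q (initSeg x n) := by
  choose! f hf using hs
  let e : ℕ → List ℕ := fun n => Nat.rec ρ (fun _ l => l ++ [f l]) n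
  have hes : ∀ n, e (n + 1) = e n ++ [f (e n)] := fun n => rfl
  have hQ : ∀ n, Q (e n) := by
    intro n
    induction n with
    | zero => exact h0
    | succ n ih => rw [hes]; exact hf _ ih
  let x : ℕ → ℕ := fun i => if h : i < ρ.length then ρ[i] else f (e (i - ρ.length))
  have hx0 : initSeg x ρ.length = ρ := by
    apply List.ext_getElem
    · simp [initSeg]
    · intro i h1 h2
      simp [initSeg, x, h2]
  have hx : ∀ n, initSeg x (ρ.length + n) = e n := by
    intro n
    induction n with
    | zero => exact hx0
    | succ n ih =>
      rw [← add_assoc, initSeg_succ, ih, hes]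
      simp [x]
  refine ⟨x, hx0, fun n hn => ?_⟩
  obtain ⟨j, rfl⟩ := Nat.exists_eq_add_of_le hn
  rw [hx]; exact hQ j

/-- The tree generated from a root by successor sets. -/
inductive InT (ρ : List ℕ) (S : List ℕ → Finset ℕ) : List ℕ → Prop
  | base : InT ρ S ρ
  | step (η : List ℕ) (m : ℕ) : InT ρ S η → m ∈ S η → InT ρ S (η ++ [m])

lemma InT.root_prefix {ρ : List ℕ} {S : List ℕ → Finset ℕ} {η : List ℕ} (h : InT ρ S η) :
    ρ <+: η := by
  induction h with
  | base => exact List.prefix_rfl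
  | step η m _ _ ih => exact ih.trans (List.prefix_append _ _)

lemma InT.closed {ρ : List ℕ} {S : List ℕ → Finset ℕ} {η : List ℕ} (h : InT ρ S η)
    (ν : List ℕ) (h1 : ρ <+: ν) (h2 : ν <+: η) : InT ρ S ν := by
  induction h with
  | base =>
    have : ν = ρ := h2.eq_of_length (le_antisymm h2.length_le h1.length_le)
    rw [this]; exact .base
  | step η m hη hm ih =>
    rcases List.prefix_concat_iff.1 h2 with h | h
    · rw [h]; simpa using InT.step η m hη hm
    · exact ih h

lemma InT.succ {ρ : List ℕ} {S : List ℕ → Finset ℕ} {η ν : List ℕ} (h : InT ρ S η)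
    (hν : InT ρ S ν) (h1 : η <+: ν) (h2 : ν.length = η.length + 1) :
    ∃ m ∈ S η, η ++ [m] = ν := by
  cases hν with
  | base =>
    have := h.root_prefix.length_le
    omega
  | step η' m hη' hm =>
    have hl : η.length = η'.length := by simpa using h2.symm
    have : η = η' := by
      rcases List.prefix_concat_iff.1 h1 with h | h
      · have := congrArg List.length h
        simp at this; omega
      · exact h.eq_of_length hl
    subst this
    exact ⟨m, hm, rfl⟩

lemma build {φ : ℕ → ℕ → ℕ} (hφ : ∀ k : ℕ, PhiCond k (φ k)) (p : Cond φ) (hp4 : Qtree4 p)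
    (d : List ℕ → ℝ) (d0 : ∀ η, 0 ≤ d η) (d1 : ∀ η, d η ≤ 1)
    (dav : ∀ η ∈ p.tree, d η ≤ (2 : ℝ) ^ (((pdom (Nval φ η.length) (p.c η).g).card : ℤ) -
      (Nval φ η.length : ℤ)) * ∑ m ∈ (p.c η).P, d (η ++ [m]))
    (η0 : List ℕ) (hη0 : η0 ∈ p.tree) (hnor : ∀ ρ ∈ p.tree, η0 <+: ρ → 1 ≤ (p.c ρ).n)
    (hd : del η0.length ≤ d η0) :
    ∃ pstar : Cond φ, Qtree4 pstar ∧ 0 < muF pstar ∧ CondLe p pstar ∧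
      ∀ η ∈ pstar.tree, 0 < d η := by
  classical
  let Good : List ℕ → Prop := fun η => η ∈ p.tree ∧ η0 <+: η ∧ del η.length ≤ d η
  have key : ∀ η, ∃ s : Crea φ, Good η → s.node = η ∧ SigR s (p.c η) ∧ (p.c η).n ≤ s.n + 1 ∧
      (∀ m ∈ s.P, Good (η ++ [m])) ∧
      ∀ r : List ℕ → ℝ, (∀ m ∈ s.P, cw (η ++ [m]).length * d (η ++ [m]) ≤ r (η ++ [m])) →
        cw η.length * d η ≤ Fst s r := by
    intro η
    by_cases hG : Good η
    · obtain ⟨h1, h2, h3⟩ := hG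
      have hnode := p.c_node η h1
      obtain ⟨s, s1, s2, s3, s4, s5⟩ := step_crea hφ (p.c η) (hnor η h1 h2)
        (fun m => d (η ++ [m])) (fun m => d0 _) (fun m => d1 _) (d η)
        (by rw [hnode]; exact dav η h1) (by rw [hnode]; exact h3)
      rw [hnode] at s1 s4 s5
      refine ⟨s, fun _ => ⟨s1, s2, s3, fun m hm => ⟨?_, ?_, ?_⟩, fun r hr => ?_⟩⟩
      · refine ((p.succ_eq η h1 (η ++ [m])).2 ?_).1
        rw [Crea.pos, hnode]
        exact Finset.mem_image_of_mem _ (s2.2.2.2 hm)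
      · exact h2.trans (List.prefix_append _ _)
      · simpa using s4 m hm
      · apply s5
        intro m hm
        simpa using hr m hm
    · exact ⟨p.c η, fun h => absurd h hG⟩
  choose c hc using key
  let S : List ℕ → Finset ℕ := fun η => (c η).P
  have hgood : ∀ η, InT η0 S η → Good η := by
    intro η h
    induction h with
    | base => exact ⟨hη0, List.prefix_rfl, hd⟩
    | step η m _ hm ih => exact (hc η ih).2.2.2.1 m hm
  let ps : Cond φ :=
    { tree := {η | InT η0 S η}
      root := η0
      root_mem := InT.base
      root_le := fun η h => InT.root_prefix h
      closed := fun η h ν h1 h2 => InT.closed h ν h1 h2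
      c := c
      c_node := fun η h => (hc η (hgood η h)).1
      succ_eq := by
        intro η h ν
        have hnode := (hc η (hgood η h)).1
        constructor
        · rintro ⟨h1, h2, h3⟩
          obtain ⟨m, hm, rfl⟩ := InT.succ h h1 h2 h3
          rw [Crea.pos, hnode]
          exact Finset.mem_image_of_mem _ hm
        · intro h1
          rw [Crea.pos, hnode, Finset.mem_image] at h1
          obtain ⟨m, hm, rfl⟩ := h1
          exact ⟨InT.step η m h hm, List.prefix_append _ _, by simp⟩ }
  have hchild : ∀ η, InT η0 S η → ∃ m, InT η0 S (η ++ [m]) := by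
    intro η h
    obtain ⟨m, hm⟩ := (c η).P_ne
    exact ⟨m, InT.step η m h hm⟩
  refine ⟨ps, ?_, ?_, ⟨fun η h => (hgood η h).1, fun η h => (hc η (hgood η h)).2.1⟩,
    fun η h => lt_of_lt_of_le (del_pos _) (hgood η h).2.2⟩
  · intro n
    obtain ⟨A, ⟨hA1, hA2⟩, hA3⟩ := hp4 (n + 1)
    refine ⟨{ρ | InT η0 S ρ ∧ ∃ ν ∈ A, ν <+: ρ}, ⟨fun ρ hρ => ⟨hρ.1, hρ.1.root_prefix⟩, ?_⟩, ?_⟩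
    · intro x hx
      obtain ⟨hx1, hx2⟩ := hx
      change initSeg x η0.length = η0 at hx1
      change ∀ n, η0.length ≤ n → InT η0 S (initSeg x n) at hx2
      have hr := p.root_le η0 hη0
      have hb : IsBranchAt p p.root x := by
        refine ⟨initSeg_eq_of_prefix x p.root η0.length (by rw [hx1]; exact hr), fun j hj => ?_⟩
        by_cases h : η0.length ≤ j
        · exact (hgood _ (hx2 j h)).1
        · apply p.closed η0 hη0
          · have e := initSeg_eq_of_prefix x p.root η0.length (by rw [hx1]; exact hr)
            rw [← e]
            exact initSeg_prefix x hj
          · conv_rhs => rw [← hx1]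
            exact initSeg_prefix x (by omega)
      obtain ⟨j, hj⟩ := hA2 x hb
      refine ⟨max j η0.length, hx2 _ (le_max_right _ _), _, hj, initSeg_prefix x (le_max_left _ _)⟩
    · rintro ν ⟨hν, a, ha, haν⟩ ρ hρ hνρ
      have h1 := hgood ρ hρ
      have h2 := hA3 a ha ρ h1.1 (haν.trans hνρ)
      have h3 := (hc ρ h1).2.2.1
      change n ≤ (c ρ).n
      omega
  · have hpos : 0 < cw η0.length * d η0 :=
      mul_pos (cw_pos _) (lt_of_lt_of_le (del_pos _) hd)
    refine lt_of_lt_of_le hpos ?_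
    apply le_csInf
    · refine ⟨_, {η0}, fun ρ => if ρ = η0 then 1 else 0, ⟨?_, ?_⟩, ⟨?_, ?_, ?_⟩, rfl⟩
      · rintro ρ rfl
        exact ⟨InT.base, List.prefix_rfl⟩
      · intro x hx
        exact ⟨η0.length, hx.1⟩
      · rintro ρ rfl
        simp
      · rintro ρ ⟨h1, h2, ν, rfl, h3⟩ h4
        exact absurd (h3.eq_of_length (le_antisymm h3.length_le h2.length_le)) h4
      · intro ρ h
        refine if_neg ?_
        rintro rfl
        exact h ⟨InT.base, List.prefix_rfl, ρ, rfl, List.prefix_rfl⟩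
    · rintro _ ⟨A, m, ⟨hA1, hA2⟩, ⟨hm1, hm2, hm3⟩, rfl⟩
      change cw η0.length * d η0 ≤ m η0
      by_contra hlt
      push Not at hlt
      have hw1 : ∀ η, cw η.length * d η ≤ 1 := fun η =>
        mul_le_one₀ (cw_le_one _) (d0 _) (d1 _)
      let Bad : List ℕ → Prop := fun ρ =>
        InT η0 S ρ ∧ (∀ ν ∈ A, ¬ ν <+: ρ) ∧ m ρ < cw ρ.length * d ρ
      have hnA : ∀ ρ, m ρ < cw ρ.length * d ρ → ρ ∉ A := by
        intro ρ h hA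
        have := hm1 ρ hA
        have := hw1 ρ
        linarith
      have hb0 : Bad η0 := by
        refine ⟨InT.base, fun ν hν hp => ?_, hlt⟩
        have h2 : η0 <+: ν := (hA1 ν hν).2
        have : ν = η0 := hp.eq_of_length (le_antisymm hp.length_le h2.length_le)
        exact hnA η0 hlt (this ▸ hν)
      have hbs : ∀ η, Bad η → ∃ i, Bad (η ++ [i]) := by
        rintro η ⟨h1, h2, h3⟩
        have hcone : InCone ps ps.root A η := by
          refine ⟨h1, h1.root_prefix, ?_⟩
          obtain ⟨x, hx1, hx2⟩ := exists_branch (InT η0 S) η h1 hchild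
          have hr := h1.root_prefix
          have e : initSeg x η0.length = η0 :=
            initSeg_eq_of_prefix x η0 η.length (by rw [hx1]; exact hr)
          have hb : IsBranchAt ps ps.root x := by
            refine ⟨e, fun j hj => ?_⟩
            change η0.length ≤ j at hj
            by_cases h : η.length ≤ j
            · exact hx2 j h
            · apply InT.closed h1
              · rw [← e]
                exact initSeg_prefix x hj
              · conv_rhs => rw [← hx1]
                exact initSeg_prefix x (by omega)
          obtain ⟨j, hj⟩ := hA2 x hb
          refine ⟨_, hj, ?_⟩
          by_cases h : η.length ≤ j
          · conv_lhs => rw [← hx1]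
            exact initSeg_prefix x h
          · exfalso
            apply h2 _ hj
            conv_rhs => rw [← hx1]
            exact initSeg_prefix x (by omega)
        have hF := hm2 η hcone (hnA η h3)
        have hG := (hc η (hgood η h1)).2.2.2.2 m
        by_contra hcon
        push Not at hcon
        have : cw η.length * d η ≤ Fst (c η) m := by
          apply hG
          intro i hi
          by_contra hlt'
          push Not at hlt'
          apply hcon i
          refine ⟨InT.step η i h1 hi, fun ν hν hp => ?_, hlt'⟩
          rcases List.prefix_concat_iff.1 hp with h | h
          · apply hnA _ hlt'
            rw [← h]; exact hν
          · exact h2 ν hν h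
        rw [hF] at h3
        exact absurd this (not_le.2 h3)
      obtain ⟨x, hx1, hx2⟩ := exists_branch Bad η0 hb0 hbs
      obtain ⟨j, hj⟩ := hA2 x ⟨hx1, fun n hn => (hx2 n hn).1⟩
      exact (hx2 (max j η0.length) (le_max_right _ _)).2.1 _ hj
        (initSeg_prefix x (le_max_left _ _))

/-- Lemma `closincond`: if `p ∈ Q^mt_4(K*,Σ*,F*)`, `q` is the cover
of `p`, `λ_q` is the Borel probability measure on `[T^q]` determined by the cylinder
values, and `C ⊆ [T^p]` is closed in `[T^q]` with `λ_q(C) > 0`, then there is a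
condition `p* ∈ Q^mt_4(K*,Σ*,F*)` with `p ≤ p*` and `[T^{p*}] ⊆ C`. -/
theorem exists_stronger_condition_with_branches_in_closed_set
    (φ : ℕ → ℕ → ℕ) (hφ : ∀ k : ℕ, PhiCond k (φ k))
    (p : Cond φ) (hp4 : Qtree4 p) (hpμ : 0 < muF p)
    (q : Cond φ) (hq : IsCover p q)
    (lam : Measure (BranchSet q))
    (hlam : ∀ ν ∈ q.tree,
      lam {x : BranchSet q | initSeg (x : ℕ → ℕ) ν.length = ν} =
        ∏ i ∈ Finset.Ico q.root.length ν.length,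
          (((q.c (ν.take i)).pos.card : ENNReal))⁻¹)
    (C : Set (BranchSet q))
    (hCp : ∀ x ∈ C, IsBranchAt p p.root (x : ℕ → ℕ))
    (hCcl : IsClosed C) (hCpos : 0 < lam C) :
    ∃ pstar : Cond φ, Qtree4 pstar ∧ 0 < muF pstar ∧ CondLe p pstar ∧
      ∀ x : ℕ → ℕ, IsBranchAt pstar pstar.root x →
        ∀ hx : x ∈ BranchSet q, (⟨x, hx⟩ : BranchSet q) ∈ C := by
  classical
  obtain ⟨hroot, hsub, hqp, -⟩ := hq
  let cyl : List ℕ → Set (BranchSet q) := fun ν =>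
    {x : BranchSet q | initSeg (x : ℕ → ℕ) ν.length = ν}
  have hfin : IsFiniteMeasure lam := by
    constructor
    have h := hlam q.root q.root_mem
    have hu : {x : BranchSet q | initSeg (x : ℕ → ℕ) q.root.length = q.root} = Set.univ :=
      Set.eq_univ_of_forall fun x => x.2.1
    rw [hu] at h
    rw [h]
    simp
  let d : List ℕ → ℝ := fun η => lam.real (C ∩ cyl η) / lam.real (cyl η)
  have d0 : ∀ η, 0 ≤ d η := fun η => div_nonneg measureReal_nonneg measureReal_nonneg
  have d1 : ∀ η, d η ≤ 1 := fun η =>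
    div_le_one_of_le₀ (measureReal_mono Set.inter_subset_right) measureReal_nonneg
  have hposcard : ∀ η ∈ q.tree, (q.c η).pos.card = (q.c η).P.card := by
    intro η _
    apply Finset.card_image_of_injective
    intro a b hab
    simpa using hab
  have hcyl : ∀ η ∈ q.tree, ∀ m ∈ (q.c η).P,
      lam.real (cyl (η ++ [m])) = lam.real (cyl η) * ((q.c η).P.card : ℝ)⁻¹ := by
    intro η hη m hm
    have hmem : η ++ [m] ∈ q.tree := by
      refine ((q.succ_eq η hη (η ++ [m])).2 ?_).1
      rw [Crea.pos, q.c_node η hη]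
      exact Finset.mem_image_of_mem _ hm
    have h1 := hlam _ hmem
    have h2 := hlam _ hη
    have hle := (q.root_le η hη).length_le
    have h3 : lam (cyl (η ++ [m])) = lam (cyl η) * (((q.c η).P.card : ENNReal))⁻¹ := by
      change lam (cyl (η ++ [m])) = _ at h1
      change lam (cyl η) = _ at h2
      rw [h1, h2, List.length_append, List.length_singleton, Finset.prod_Ico_succ_top hle]
      congr 1
      · apply Finset.prod_congr rfl
        intro i hi
        rw [List.take_append_of_le_length (Finset.mem_Ico.1 hi).2.le]
      · rw [List.take_append_of_le_length le_rfl, List.take_length, hposcard η hη]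
    rw [measureReal_def, h3, ENNReal.toReal_mul]
    simp [measureReal_def]
  have hK : ∀ η ∈ p.tree, (2 : ℝ) ^ (((pdom (Nval φ η.length) (p.c η).g).card : ℤ) -
      (Nval φ η.length : ℤ)) = ((q.c η).P.card : ℝ)⁻¹ := by
    intro η hη
    have hn := p.c_node η hη
    have hg := (p.c η).g_none
    rw [hn] at hg
    have h1 := avg_one (Nval φ η.length) (p.c η).g hg
    have h2 : (q.c η).P = (Finset.range (2 ^ Nval φ η.length)).filter
        (fun m => ExtendsNum (p.c η).g m) := by
      ext m
      rw [(hqp η hη).2.2 m]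
      simp
    unfold avg at h1
    rw [← Finset.sum_filter, Finset.sum_const, nsmul_eq_mul, mul_one, ← h2] at h1
    exact eq_inv_of_mul_eq_one_left h1
  have hPsub : ∀ η ∈ p.tree, (p.c η).P ⊆ (q.c η).P := by
    intro η hη m hm
    rw [(hqp η hη).2.2 m]
    have := (p.c η).P_ok m hm
    rwa [p.c_node η hη] at this
  have dav : ∀ η ∈ p.tree, d η ≤ (2 : ℝ) ^ (((pdom (Nval φ η.length) (p.c η).g).card : ℤ) -
      (Nval φ η.length : ℤ)) * ∑ m ∈ (p.c η).P, d (η ++ [m]) := by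
    intro η hη
    rw [hK η hη]
    have hcover : C ∩ cyl η ⊆ ⋃ m ∈ (p.c η).P, C ∩ cyl (η ++ [m]) := by
      rintro x ⟨hxC, hxη⟩
      change initSeg (x : ℕ → ℕ) η.length = η at hxη
      have hb := hCp x hxC
      have hle := (p.root_le η hη).length_le
      have hmem := hb.2 (η.length + 1) (by omega)
      have he : initSeg (x : ℕ → ℕ) (η.length + 1) = η ++ [(x : ℕ → ℕ) η.length] := by
        rw [initSeg_succ, hxη]
      rw [he] at hmem
      have hp := (p.succ_eq η hη _).1 ⟨hmem, List.prefix_append _ _, by simp⟩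
      rw [Crea.pos, p.c_node η hη, Finset.mem_image] at hp
      obtain ⟨m, hm, hme⟩ := hp
      have hmx : m = (x : ℕ → ℕ) η.length := by simpa using hme
      simp only [Set.mem_iUnion]
      refine ⟨m, hm, hxC, ?_⟩
      change initSeg (x : ℕ → ℕ) (η ++ [m]).length = η ++ [m]
      rw [List.length_append, List.length_singleton, he, hmx]
    have h1 : lam.real (C ∩ cyl η) ≤ ∑ m ∈ (p.c η).P, lam.real (C ∩ cyl (η ++ [m])) :=
      (measureReal_mono hcover (measure_ne_top _ _)).trans (measureReal_biUnion_finset_le _ _)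
    have h2 : d η ≤ ∑ m ∈ (p.c η).P, lam.real (C ∩ cyl (η ++ [m])) / lam.real (cyl η) := by
      rw [← Finset.sum_div]
      exact div_le_div_of_nonneg_right h1 measureReal_nonneg
    refine h2.trans (le_of_eq ?_)
    rw [Finset.mul_sum]
    apply Finset.sum_congr rfl
    intro m hm
    change _ = _ * (lam.real (C ∩ cyl (η ++ [m])) / lam.real (cyl (η ++ [m])))
    have hm' := hPsub η hη hm
    rw [hcyl η (hsub hη) m hm']
    have hc0 : ((q.c η).P.card : ℝ) ≠ 0 := by
      have : 0 < (q.c η).P.card := Finset.card_pos.2 ⟨m, hm'⟩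
      positivity
    by_cases hL : lam.real (cyl η) = 0
    · simp [hL]
    · field_simp
  have hstep : ∀ a : ℝ, 0 < a → ∀ η ∈ p.tree, a ≤ d η →
      ∃ m, η ++ [m] ∈ p.tree ∧ a ≤ d (η ++ [m]) := by
    intro a ha η hη had
    by_contra hcon
    push Not at hcon
    have h1 := dav η hη
    rw [hK η hη] at h1
    have h2 : ∑ m ∈ (p.c η).P, d (η ++ [m]) < ∑ m ∈ (p.c η).P, a := by
      apply Finset.sum_lt_sum_of_nonempty (p.c η).P_ne
      intro m hm
      apply hcon m
      refine ((p.succ_eq η hη (η ++ [m])).2 ?_).1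
      rw [Crea.pos, p.c_node η hη]
      exact Finset.mem_image_of_mem _ hm
    rw [Finset.sum_const, nsmul_eq_mul] at h2
    have h3 : ((p.c η).P.card : ℝ) ≤ (q.c η).P.card := by
      exact_mod_cast Finset.card_le_card (hPsub η hη)
    have h4 : (0 : ℝ) < (q.c η).P.card := by
      exact_mod_cast Finset.card_pos.2 (q.c η).P_ne
    rw [inv_mul_eq_div, le_div_iff₀ h4] at h1
    nlinarith
  obtain ⟨A, ⟨hA1, hA2⟩, hA3⟩ := hp4 1
  obtain ⟨ν, hνA, hν⟩ : ∃ ν ∈ A, 0 < lam.real (C ∩ cyl ν) := by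
    by_contra hcon
    push Not at hcon
    have h1 : lam (⋃ ν ∈ A, C ∩ cyl ν) = 0 := by
      rw [measure_biUnion_null_iff A.to_countable]
      intro ν hν
      have := le_antisymm (hcon ν hν) measureReal_nonneg
      rwa [measureReal_eq_zero_iff] at this
    have h2 : C ⊆ ⋃ ν ∈ A, C ∩ cyl ν := by
      intro x hx
      obtain ⟨n, hn⟩ := hA2 x (hCp x hx)
      simp only [Set.mem_iUnion]
      refine ⟨_, hn, hx, ?_⟩
      change initSeg (x : ℕ → ℕ) (initSeg (x : ℕ → ℕ) n).length = _
      rw [initSeg_length]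
    exact hCpos.ne' (measure_mono_null h2 h1)
  have hda : 0 < d ν := div_pos hν (hν.trans_le (measureReal_mono Set.inter_subset_right))
  have hext : ∀ n : ℕ, ∃ η ∈ p.tree, ν <+: η ∧ η.length = ν.length + n ∧ d ν ≤ d η := by
    intro n
    induction n with
    | zero => exact ⟨ν, (hA1 ν hνA).1, List.prefix_rfl, rfl, le_rfl⟩
    | succ n ih =>
      obtain ⟨η, h1, h2, h3, h4⟩ := ih
      obtain ⟨m, h5, h6⟩ := hstep _ hda η h1 h4
      exact ⟨_, h5, h2.trans (List.prefix_append _ _), by simp [h3]; omega, h6⟩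
  obtain ⟨n, hn⟩ := exists_pow_lt_of_lt_one hda (show (1 / 2 : ℝ) < 1 by norm_num)
  obtain ⟨η0, h1, h2, h3, h4⟩ := hext n
  have hdel : del η0.length ≤ d η0 := by
    refine le_trans ?_ (hn.le.trans h4)
    rw [del, one_div, inv_pow]
    apply inv_anti₀ (by positivity)
    apply pow_le_pow_right₀ (by norm_num)
    have : η0.length + 4 < 2 ^ (η0.length + 4) := Nat.lt_two_pow_self
    omega
  obtain ⟨ps, g1, g2, g3, g4⟩ := build hφ p hp4 d d0 d1 dav η0 h1
    (fun ρ hρ hr => hA3 ν hνA ρ hρ (h2.trans hr)) hdel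
  refine ⟨ps, g1, g2, g3, ?_⟩
  intro x hx hxq
  have hne : ∀ n, ∃ y ∈ C, initSeg (y : ℕ → ℕ) (max n ps.root.length) =
      initSeg x (max n ps.root.length) := by
    intro n
    have hpos := g4 _ (hx.2 (max n ps.root.length) (le_max_right _ _))
    have : (C ∩ cyl (initSeg x (max n ps.root.length))).Nonempty := by
      by_contra hcon
      rw [Set.not_nonempty_iff_eq_empty] at hcon
      simp [d, hcon] at hpos
    obtain ⟨y, hyC, hy⟩ := this
    refine ⟨y, hyC, ?_⟩
    change initSeg (y : ℕ → ℕ) (initSeg x _).length = _ at hy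
    rwa [initSeg_length] at hy
  choose y hyC hy using hne
  refine hCcl.mem_of_tendsto (b := Filter.atTop) (f := y) ?_ (Filter.Eventually.of_forall hyC)
  rw [tendsto_subtype_rng, tendsto_pi_nhds]
  intro i
  apply tendsto_const_nhds.congr'
  filter_upwards [Filter.eventually_gt_atTop i] with n hn
  have h := congrArg (fun l : List ℕ => l[i]?) (hy n)
  have hi : i < max n ps.root.length := lt_of_lt_of_le hn (le_max_left _ _)
  simp only [initSeg, List.getElem?_map, List.getElem?_range hi, Option.map_some] at h
  exact (Option.some.inj h).symm

end ConcreteForcing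
end
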